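/- Fix λ > 0 and β ∈ (0,2). Define ℒ₀(t,x) = λ² · G_β(t,x)², ℒ_n = ℒ_{n−1} ⋆ ℒ₀ for n ≥ 1 (space-time convolution on (0,∞) × ℝ), and 𝒦(t,x;λ) = ∑_{n=0}^∞ ℒ_n(t,x). Then there exists a finite constant C = C(β,λ) such that for all t > 0 and x ∈ ℝ, 𝒦(t,x;λ) ≤ (C / t^σ) · 𝒢_β(t,x) · (1 + t^σ · exp(Υ t)), where σ = β/2 + 2(1 − ⌈β⌉), Υ = (λ² · Ψ_β · C̃_β · Γ(1−σ))^{1/(1−σ)}, Ψ_β = sup_{x ∈ ℝ} G_β(1,x)²/𝒢_β(1,x), and C̃_β = (2^{β/2}/(2^{β/2}−1))·exp(−2^{−β/2}) if 0 < β < 1 while C̃_β = 2^{(β−1)/2} if 1 ≤ β < 2. -/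

import Mathlib

open MeasureTheory

/-- The two-parameter Mainardi function `M_{λ,μ}(z) = ∑ (−z)^n / (n! Γ(μ − (n+1)λ))`. -/
noncomputable def mainardiR (lam mu z : ℝ) : ℝ :=
  ∑' n : ℕ, (-z) ^ n / ((n.factorial : ℝ) * Real.Gamma (mu - ((n : ℝ) + 1) * lam))

/-- The Green function `G_β(t,x) = (t^{⌈β⌉−1−β/2}/2) M_{β/2,⌈β⌉}(|x|/t^{β/2})`. -/
noncomputable def greenG (β t x : ℝ) : ℝ :=
  t ^ ((⌈β⌉₊ : ℝ) - 1 - β / 2) / 2 * mainardiR (β / 2) (⌈β⌉₊ : ℝ) (|x| / t ^ (β / 2))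

/-- The reference kernel `𝒢_β`: exponential for `0 < β < 1`, Gaussian for `1 ≤ β < 2`. -/
noncomputable def refKernel (β t x : ℝ) : ℝ :=
  if β < 1 then 1 / (2 * t ^ (β / 2)) * Real.exp (-|x| / t ^ (β / 2))
  else (4 * Real.pi * t ^ β) ^ (-(1 : ℝ) / 2) * Real.exp (-x ^ 2 / (4 * t ^ β))

/-- Space-time convolution on `(0,∞) × ℝ`. -/
noncomputable def stConv (f g : ℝ → ℝ → ℝ) : ℝ → ℝ → ℝ :=
  fun t x => ∫ s in Set.Ioc (0 : ℝ) t, ∫ y : ℝ, f (t - s) (x - y) * g s y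

/-- The iterated space-time convolutions `ℒ_n`: `ℒ_0 = L0`, `ℒ_n = ℒ_{n−1} ⋆ ℒ_0`. -/
noncomputable def iterL (L0 : ℝ → ℝ → ℝ) : ℕ → ℝ → ℝ → ℝ
  | 0 => L0
  | n + 1 => stConv (iterL L0 n) L0


lemma HasSum.congr_fun' {E : Type*} [AddCommMonoid E] [TopologicalSpace E] {f g : ℕ → E} {a : E}
    (h : HasSum f a) (e : ∀ n, g n = f n) : HasSum g a := by
  rw [funext e]; exact h

lemma exp_image_univ : Real.exp '' Set.univ = Set.Ioi 0 := by
  rw [Set.image_univ, Real.range_exp]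

lemma integrable_gumbel (k b : ℝ) (hk : 0 < k) (hb : 0 < b) :
    Integrable (fun ξ : ℝ => Real.exp (-k * Real.exp ξ + b * ξ)) := by
  have h1 : IntegrableOn (fun u : ℝ => u ^ (b - 1) * Real.exp (-k * u)) (Set.Ioi 0) := by
    have := integrableOn_rpow_mul_exp_neg_mul_rpow (s := b - 1) (p := 1) (b := k) (by linarith)
      one_pos hk
    simpa using this
  rw [← exp_image_univ, integrableOn_image_iff_integrableOn_abs_deriv_smul MeasurableSet.univ
    (fun x _ => (Real.hasDerivAt_exp x).hasDerivWithinAt) Real.exp_injective.injOn] at h1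
  rw [integrableOn_univ] at h1
  refine h1.congr (Filter.Eventually.of_forall fun ξ => ?_)
  simp only [smul_eq_mul, abs_of_pos (Real.exp_pos ξ)]
  rw [← Real.exp_mul, ← Real.exp_add, ← Real.exp_add]
  congr 1; ring

lemma integral_gumbel (a : ℝ) (ha : 0 < a) :
    ∫ ξ : ℝ, Real.exp (-Real.exp ξ + a * ξ) = Real.Gamma a := by
  rw [Real.Gamma_eq_integral ha, ← exp_image_univ,
    integral_image_eq_integral_abs_deriv_smul MeasurableSet.univ
    (fun x _ => (Real.hasDerivAt_exp x).hasDerivWithinAt) Real.exp_injective.injOn, setIntegral_univ]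
  congr 1; ext ξ
  simp only [smul_eq_mul, abs_of_pos (Real.exp_pos ξ)]
  rw [← Real.exp_mul, ← Real.exp_add, ← Real.exp_add]
  congr 1; ring

/-- `x u^ν ≤ (k/2) u + C` in logarithmic variable. -/
lemma sublinear_bound (ν x k : ℝ) (hν0 : 0 < ν) (hν1 : ν < 1) (hx : 0 ≤ x) (hk : 0 < k) :
    ∃ C : ℝ, ∀ ξ : ℝ, x * Real.exp (ν * ξ) ≤ k * Real.exp ξ + C := by
  have ht : Filter.Tendsto (fun ξ : ℝ => k * Real.exp ((1 - ν) * ξ)) Filter.atTop Filter.atTop := by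
    refine Filter.Tendsto.const_mul_atTop hk (Real.tendsto_exp_atTop.comp ?_)
    exact Filter.Tendsto.const_mul_atTop (by linarith) Filter.tendsto_id
  obtain ⟨R, hR⟩ := Filter.eventually_atTop.1 (ht.eventually_ge_atTop x)
  refine ⟨x * Real.exp (ν * R), fun ξ => ?_⟩
  rcases le_total R ξ with h | h
  · have := hR ξ h
    have h2 : k * Real.exp ξ = k * Real.exp ((1 - ν) * ξ) * Real.exp (ν * ξ) := by
      rw [mul_assoc, ← Real.exp_add]; congr 2; ring
    have : x * Real.exp (ν * ξ) ≤ k * Real.exp ξ := by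
      rw [h2]; gcongr
    have : 0 ≤ x * Real.exp (ν * R) := by positivity
    linarith
  · have : x * Real.exp (ν * ξ) ≤ x * Real.exp (ν * R) := by gcongr
    have : 0 < k * Real.exp ξ := by positivity
    linarith

lemma integrable_gumbel2 (k b x ν : ℝ) (hk : 0 < k) (hb : 0 < b) (hν0 : 0 < ν) (hν1 : ν < 1)
    (hx : 0 ≤ x) :
    Integrable (fun ξ : ℝ => Real.exp (-k * Real.exp ξ + x * Real.exp (ν * ξ) + b * ξ)) := by
  obtain ⟨C, hC⟩ := sublinear_bound ν x (k / 2) hν0 hν1 hx (by positivity)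
  refine ((integrable_gumbel (k / 2) b (by positivity) hb).const_mul (Real.exp C)).mono'
    (by fun_prop) (Filter.Eventually.of_forall fun ξ => ?_)
  rw [Real.norm_eq_abs, abs_of_pos (Real.exp_pos _), ← Real.exp_add]
  apply Real.exp_le_exp.2
  have := hC ξ
  linarith

/-- the log-plane integrand -/
noncomputable def wf (x ν b : ℝ) (p : ℂ) : ℂ :=
  Complex.exp (Complex.exp p - x * Complex.exp (ν * p) + b * p)

lemma wf_diff (x ν b : ℝ) : Differentiable ℂ (wf x ν b) := by
  unfold wf; fun_prop

lemma norm_wf (x ν b ξ η : ℝ) : ‖wf x ν b (ξ + η * Complex.I)‖ =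
    Real.exp (Real.exp ξ * Real.cos η - x * (Real.exp (ν * ξ) * Real.cos (ν * η)) + b * ξ) := by
  unfold wf
  rw [Complex.norm_exp]
  congr 1
  have : (ν : ℂ) * (ξ + η * Complex.I) = ((ν * ξ : ℝ) : ℂ) + ((ν * η : ℝ) : ℂ) * Complex.I := by
    push_cast; ring
  rw [this]
  simp [Complex.exp_re]

lemma left_limit (f : ℂ → ℂ) (hf : Differentiable ℂ f) (c d B : ℝ) (h : ℝ → ℝ)
    (hh : Filter.Tendsto h Filter.atBot (nhds 0))
    (hb : ∀ A : ℝ, A ≤ B → ∀ y ∈ Set.uIcc c d, ‖f (A + y * Complex.I)‖ ≤ h A)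
    (hc : IntegrableOn (fun ξ : ℝ => f (ξ + c * Complex.I)) (Set.Iic B))
    (hd : IntegrableOn (fun ξ : ℝ => f (ξ + d * Complex.I)) (Set.Iic B)) :
    (∫ ξ in Set.Iic B, f (ξ + c * Complex.I)) - (∫ ξ in Set.Iic B, f (ξ + d * Complex.I))
      + Complex.I * ∫ y in c..d, f (B + y * Complex.I) = 0 := by
  have h1 := intervalIntegral_tendsto_integral_Iic B hc Filter.tendsto_id
  have h2 := intervalIntegral_tendsto_integral_Iic B hd Filter.tendsto_id
  have h3 : Filter.Tendsto (fun A : ℝ => Complex.I * ∫ y in c..d, f (A + y * Complex.I))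
      Filter.atBot (nhds 0) := by
    refine squeeze_zero_norm' (a := fun A => h A * |d - c|) ?_ (by simpa using hh.mul_const |d - c|)
    filter_upwards [Filter.eventually_le_atBot B] with A hA
    rw [norm_mul, Complex.norm_I, one_mul]
    apply intervalIntegral.norm_integral_le_of_norm_le_const
    intro y hy
    exact hb A hA y (Set.uIoc_subset_uIcc hy)
  have h4 := ((h1.sub h2).add_const (Complex.I * ∫ y in c..d, f (B + y * Complex.I))).sub h3
  rw [sub_zero] at h4
  refine tendsto_nhds_unique h4 ?_
  refine tendsto_const_nhds.congr fun A => ?_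
  have := Complex.integral_boundary_rect_eq_zero_of_differentiableOn f (A + c * Complex.I)
    (B + d * Complex.I) hf.differentiableOn
  simp at this
  simpa using this.symm

lemma shift_eq (f : ℂ → ℂ) (hf : Differentiable ℂ f) (c d : ℝ) (h : ℝ → ℝ)
    (hh : Filter.Tendsto h Filter.atBot (nhds 0)) (hh' : Filter.Tendsto h Filter.atTop (nhds 0))
    (hb : ∀ A : ℝ, ∀ y ∈ Set.uIcc c d, ‖f (A + y * Complex.I)‖ ≤ h A)
    (hc : Integrable (fun ξ : ℝ => f (ξ + c * Complex.I)))
    (hd : Integrable (fun ξ : ℝ => f (ξ + d * Complex.I))) :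
    (∫ ξ : ℝ, f (ξ + c * Complex.I)) = (∫ ξ : ℝ, f (ξ + d * Complex.I)) := by
  rw [← sub_eq_zero]
  have h3 : Filter.Tendsto (fun A : ℝ => Complex.I * ∫ y in c..d, f (A + y * Complex.I))
      Filter.atTop (nhds 0) := by
    refine squeeze_zero_norm' (a := fun A => h A * |d - c|) ?_ (by simpa using hh'.mul_const |d - c|)
    refine Filter.Eventually.of_forall fun A => ?_
    rw [norm_mul, Complex.norm_I, one_mul]
    apply intervalIntegral.norm_integral_le_of_norm_le_const
    intro y hy
    exact hb A y (Set.uIoc_subset_uIcc hy)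
  have h1 := (aecover_Iic (μ := volume) (Filter.tendsto_id (α := ℝ) (x := Filter.atTop))).integral_tendsto_of_countably_generated hc
  have h2 := (aecover_Iic (μ := volume) (Filter.tendsto_id (α := ℝ) (x := Filter.atTop))).integral_tendsto_of_countably_generated hd
  have h4 := (h1.sub h2).add h3
  rw [add_zero] at h4
  refine tendsto_nhds_unique h4 ?_
  refine tendsto_const_nhds.congr fun B => ?_
  exact (left_limit f hf c d B h hh (fun A _ => hb A) hc.integrableOn hd.integrableOn).symm

/-- `exp(-k e^ξ + bξ) → 0` at both ends. -/
lemma gumbel_atBot (k b : ℝ) (hb : 0 < b) :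
    Filter.Tendsto (fun ξ : ℝ => Real.exp (k * Real.exp ξ + b * ξ)) Filter.atBot (nhds 0) := by
  refine Real.tendsto_exp_atBot.comp ?_
  refine Filter.Tendsto.add_atBot (C := k * 0) (Real.tendsto_exp_atBot.const_mul k) ?_
  exact Filter.Tendsto.const_mul_atBot hb Filter.tendsto_id

lemma gumbel_atTop (k b : ℝ) (hk : 0 < k) :
    Filter.Tendsto (fun ξ : ℝ => Real.exp (-k * Real.exp ξ + b * ξ)) Filter.atTop (nhds 0) := by
  refine Real.tendsto_exp_atBot.comp ?_
  have h1 : Filter.Tendsto (fun ξ : ℝ => ξ * (k * (Real.exp ξ / ξ^1) - b)) Filter.atTop Filter.atTop := by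
    refine Filter.Tendsto.atTop_mul_atTop₀ Filter.tendsto_id ?_
    refine Filter.tendsto_atTop_add_const_right _ _ ?_
    exact Filter.Tendsto.const_mul_atTop hk (Real.tendsto_exp_div_pow_atTop 1)
  have h2 := Filter.tendsto_neg_atTop_atBot.comp h1
  refine h2.congr' ?_
  filter_upwards [Filter.eventually_gt_atTop 0] with ξ hξ
  simp only [Function.comp]
  field_simp
  ring

lemma integrable_line (f : ℂ → ℂ) (hf : Differentiable ℂ f) (η : ℝ) (g : ℝ → ℝ) (s : Set ℝ)
    (hg : IntegrableOn g s) (hs : MeasurableSet s)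
    (h : ∀ ξ ∈ s, ‖f (ξ + η * Complex.I)‖ ≤ g ξ) :
    IntegrableOn (fun ξ : ℝ => f (ξ + η * Complex.I)) s := by
  refine Integrable.mono' hg ?_ ?_
  · apply Continuous.aestronglyMeasurable
    exact hf.continuous.comp (by fun_prop)
  · exact (ae_restrict_iff' hs).2 (Filter.Eventually.of_forall h)

/-- rotated Gamma integral -/
lemma gamma_rot (a η : ℝ) (ha : 0 < a) (hη : |η| < Real.pi / 2) :
    ∫ ξ : ℝ, Complex.exp (-Complex.exp (ξ + η * Complex.I) + a * (ξ + η * Complex.I)) =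
      Real.Gamma a := by
  set f : ℂ → ℂ := fun p => Complex.exp (-Complex.exp p + a * p) with hfdef
  have hf : Differentiable ℂ f := by rw [hfdef]; fun_prop
  have hk : 0 < Real.cos η := Real.cos_pos_of_mem_Ioo ⟨by linarith [abs_lt.1 hη], by linarith [abs_lt.1 hη]⟩
  have hnorm : ∀ ξ y : ℝ, y ∈ Set.uIcc 0 η → ‖f (ξ + y * Complex.I)‖ ≤
      Real.exp (-Real.cos η * Real.exp ξ + a * ξ) := by
    intro ξ y hy
    have hy' : |y| ≤ |η| := by
      have := Set.abs_sub_left_of_mem_uIcc hy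
      simpa using this
    have hcos : Real.cos η ≤ Real.cos y := by
      rw [← Real.cos_abs η, ← Real.cos_abs y]
      exact Real.cos_le_cos_of_nonneg_of_le_pi (abs_nonneg _) (by linarith [Real.pi_pos]) hy'
    rw [hfdef, Complex.norm_exp]
    apply Real.exp_le_exp.2
    simp [Complex.exp_re]
    nlinarith [Real.exp_pos ξ]
  have hIntg : ∀ y ∈ Set.uIcc 0 η, Integrable (fun ξ : ℝ => f (ξ + y * Complex.I)) := by
    intro y hy
    rw [← integrableOn_univ]
    exact integrable_line f hf y _ _ (integrable_gumbel _ a hk ha).integrableOn MeasurableSet.univ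
      (fun ξ _ => hnorm ξ y hy)
  have := shift_eq f hf 0 η _ (gumbel_atBot (-Real.cos η) a ha) (gumbel_atTop (Real.cos η) a hk)
    (fun A y hy => hnorm A y hy) (hIntg 0 Set.left_mem_uIcc) (hIntg η Set.right_mem_uIcc)
  rw [hfdef] at this
  rw [← this, ← integral_gumbel a ha, ← integral_complex_ofReal]
  congr 1; ext ξ; push_cast; simp

lemma gamma_ray (a φ : ℝ) (ha : 0 < a) (h1 : Real.pi / 2 < φ) (h2 : φ < Real.pi) :
    (∫ ξ : ℝ, Complex.exp (Complex.exp (ξ + φ * Complex.I) + a * (ξ + φ * Complex.I))).im =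
      Real.pi / Real.Gamma (1 - a) := by
  have h := gamma_rot a (φ - Real.pi) ha (by rw [abs_lt]; constructor <;> linarith [Real.pi_pos])
  have e : ∀ ξ : ℝ, Complex.exp (Complex.exp (ξ + φ * Complex.I) + a * (ξ + φ * Complex.I)) =
      Complex.exp ((Real.pi * a : ℝ) * Complex.I) * Complex.exp (-Complex.exp (ξ + (φ - Real.pi : ℝ) * Complex.I) + a * (ξ + (φ - Real.pi : ℝ) * Complex.I)) := by
    intro ξ
    have : Complex.exp (ξ + (φ - Real.pi : ℝ) * Complex.I) = - Complex.exp (ξ + φ * Complex.I) := by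
      rw [show (ξ + (φ - Real.pi : ℝ) * Complex.I : ℂ) = ξ + φ * Complex.I - Real.pi * Complex.I by
        push_cast; ring, Complex.exp_sub, Complex.exp_pi_mul_I]
      ring
    rw [this, ← Complex.exp_add]
    congr 1; push_cast; ring
  simp_rw [e]
  rw [integral_const_mul, h, Complex.im_mul_ofReal, Complex.exp_ofReal_mul_I_im]
  have hr := Real.Gamma_mul_Gamma_one_sub a
  rcases eq_or_ne (Real.sin (Real.pi * a)) 0 with h0 | h0
  · rw [h0, div_zero] at hr
    have : Real.Gamma (1 - a) = 0 := by
      rcases mul_eq_zero.1 hr with h' | h'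
      · exact absurd h' (Real.Gamma_pos_of_pos ha).ne'
      · exact h'
    rw [h0, this]; simp
  · have hne : Real.Gamma (1 - a) ≠ 0 := by
      intro h'; rw [h', mul_zero] at hr
      have := div_ne_zero Real.pi_ne_zero h0
      exact this hr.symm
    rw [eq_div_iff hne, mul_assoc, hr, mul_div_cancel₀ _ h0]

lemma wright_hasSum (x ν b φ : ℝ) (hx : 0 ≤ x) (hν0 : 0 < ν) (hν1 : ν < 1) (hb : 0 < b)
    (h1 : Real.pi / 2 < φ) (h2 : φ < Real.pi) :
    HasSum (fun n : ℕ => (-x) ^ n / (n.factorial * Real.Gamma (1 - (b + n * ν))))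
      ((∫ ξ : ℝ, wf x ν b (ξ + φ * Complex.I)).im / Real.pi) := by
  have hk : 0 < -Real.cos φ := by
    have := Real.cos_neg_of_pi_div_two_lt_of_lt h1 (by linarith); linarith
  have key : HasSum (fun n : ℕ => ∫ ξ : ℝ, ((((-x) ^ n / n.factorial : ℝ)) : ℂ) *
      Complex.exp (Complex.exp (ξ + φ * Complex.I) + ((b + n * ν : ℝ) : ℂ) * (ξ + φ * Complex.I)))
      (∫ ξ : ℝ, wf x ν b (ξ + φ * Complex.I)) := by
    have hs : ∀ ξ : ℝ, HasSum (fun n : ℕ => (x * Real.exp (ν * ξ)) ^ n / n.factorial *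
      Real.exp (-(-Real.cos φ) * Real.exp ξ + b * ξ)) (Real.exp (-(-Real.cos φ) * Real.exp ξ + x * Real.exp (ν * ξ) + b * ξ)) := by
      intro ξ
      have := (NormedSpace.expSeries_div_hasSum_exp (x * Real.exp (ν * ξ))).mul_right
        (Real.exp (-(-Real.cos φ) * Real.exp ξ + b * ξ))
      rw [← Real.exp_eq_exp_ℝ, ← Real.exp_add] at this
      have e : -(-Real.cos φ) * Real.exp ξ + x * Real.exp (ν * ξ) + b * ξ =
        x * Real.exp (ν * ξ) + (-(-Real.cos φ) * Real.exp ξ + b * ξ) := by ring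
      rw [e]; exact this
    refine hasSum_integral_of_dominated_convergence (fun n ξ => (x * Real.exp (ν * ξ)) ^ n / n.factorial *
      Real.exp (-(-Real.cos φ) * Real.exp ξ + b * ξ)) ?_ ?_ ?_ ?_ ?_
    · intro n
      apply Continuous.aestronglyMeasurable; fun_prop
    · intro n
      refine Filter.Eventually.of_forall fun ξ => ?_
      rw [norm_mul, Complex.norm_exp, Complex.norm_real, norm_div, norm_pow, norm_neg, mul_pow,
        Real.norm_of_nonneg hx]
      simp only [RCLike.norm_natCast]
      rw [show x ^ n * Real.exp (ν * ξ) ^ n / n.factorial * Real.exp (-(-Real.cos φ) * Real.exp ξ + b * ξ) = x ^ n / n.factorial * (Real.exp (ν * ξ) ^ n  * Real.exp (-(-Real.cos φ) * Real.exp ξ + b * ξ)) by ring]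
      rw [← Real.exp_nat_mul, ← Real.exp_add]
      apply le_of_eq
      congr 2
      simp [Complex.exp_re]
      ring
    · exact Filter.Eventually.of_forall fun ξ => (hs ξ).summable
    · refine (integrable_gumbel2 (-Real.cos φ) b x ν hk hb hν0 hν1 hx).congr ?_
      exact Filter.Eventually.of_forall fun ξ => (hs ξ).tsum_eq.symm
    · refine Filter.Eventually.of_forall fun ξ => ?_
      have := (NormedSpace.expSeries_div_hasSum_exp (-x * Complex.exp (ν * (ξ + φ * Complex.I)))).mul_right
        (Complex.exp (Complex.exp (ξ + φ * Complex.I) + b * (ξ + φ * Complex.I)))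
      rw [← Complex.exp_eq_exp_ℂ, ← Complex.exp_add] at this
      have e1 : wf x ν b (ξ + φ * Complex.I) = Complex.exp (-x * Complex.exp (ν * (ξ + φ * Complex.I)) +
        (Complex.exp (ξ + φ * Complex.I) + b * (ξ + φ * Complex.I))) := by
        unfold wf
        congr 1; ring
      rw [e1]
      refine this.congr_fun' ?_
      · intro n
        rw [mul_pow, ← Complex.exp_nat_mul]
        push_cast
        rw [mul_div_right_comm, mul_assoc ((-(x:ℂ)) ^ n / n.factorial), ← Complex.exp_add]
        congr 2; ring
  have := (Complex.imCLM.hasSum key).div_const Real.pi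
  simp only [Complex.imCLM_apply] at this
  refine this.congr_fun' ?_
  intro n
  rw [integral_const_mul, Complex.im_ofReal_mul, gamma_ray _ φ (by positivity) h1 h2]
  have := Real.pi_ne_zero
  field_simp


lemma wf_real_im (x ν b ξ : ℝ) : (wf x ν b (ξ + (0:ℝ) * Complex.I)).im = 0 := by
  have : wf x ν b (ξ + (0:ℝ) * Complex.I) =
      ((Real.exp (Real.exp ξ - x * Real.exp (ν * ξ) + b * ξ) : ℝ) : ℂ) := by
    unfold wf; push_cast; simp
  rw [this, Complex.ofReal_im]

lemma wright_bound (ν b φ : ℝ) (hν0 : 0 < ν) (hν1 : ν < 1) (hb : 0 < b)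
    (h1 : Real.pi / 2 < φ) (h2 : φ < Real.pi) (h3 : ν * φ < Real.pi / 2) :
    ∃ K : ℝ, 0 < K ∧ ∀ x : ℝ, 0 ≤ x → ∀ B : ℝ,
      |(∫ ξ : ℝ, wf x ν b (ξ + φ * Complex.I)).im / Real.pi| ≤
        K * (Real.exp (-(Real.cos (ν * φ) * x * Real.exp (ν * B))) *
          (1 + Real.exp (Real.exp B + b * B))) := by
  have hpi := Real.pi_pos
  have hφ0 : 0 < φ := by linarith
  set κ := Real.cos (ν * φ) with hκdef
  have hκ : 0 < κ := Real.cos_pos_of_mem_Ioo ⟨by nlinarith, h3⟩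
  have hk : 0 < -Real.cos φ := by
    have := Real.cos_neg_of_pi_div_two_lt_of_lt h1 (by linarith); linarith
  have hcos : ∀ y ∈ Set.uIcc 0 φ, κ ≤ Real.cos (ν * y) := by
    intro y hy
    rw [Set.uIcc_of_le hφ0.le] at hy
    apply Real.cos_le_cos_of_nonneg_of_le_pi
    · exact mul_nonneg hν0.le hy.1
    · nlinarith
    · exact mul_le_mul_of_nonneg_left hy.2 hν0.le
  set K0 := ∫ ξ : ℝ, Real.exp (-(-Real.cos φ) * Real.exp ξ + b * ξ) with hK0
  have hK0nn : 0 ≤ K0 := integral_nonneg fun ξ => (Real.exp_pos _).le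
  refine ⟨K0 + φ, by positivity, fun x hx B => ?_⟩
  have hwf := wf_diff x ν b
  -- integrability on the ray
  have hray : ∀ ξ : ℝ, ‖wf x ν b (ξ + φ * Complex.I)‖ ≤
      Real.exp (-(-Real.cos φ) * Real.exp ξ + b * ξ) := by
    intro ξ
    rw [norm_wf]
    apply Real.exp_le_exp.2
    have : 0 ≤ x * (Real.exp (ν * ξ) * Real.cos (ν * φ)) := by positivity
    linarith
  have hIntg : Integrable (fun ξ : ℝ => wf x ν b (ξ + φ * Complex.I)) := by
    rw [← integrableOn_univ]
    exact integrable_line _ hwf φ _ _ (integrable_gumbel _ b hk hb).integrableOn MeasurableSet.univ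
      (fun ξ _ => hray ξ)
  have hleft : ∀ A : ℝ, A ≤ B → ∀ y ∈ Set.uIcc 0 φ, ‖wf x ν b (A + y * Complex.I)‖ ≤
      Real.exp (1 * Real.exp A + b * A) := by
    intro A _ y hy
    rw [norm_wf]
    apply Real.exp_le_exp.2
    have : 0 ≤ x * (Real.exp (ν * A) * Real.cos (ν * y)) := by
      have := hκ.trans_le (hcos y hy)
      positivity
    have : Real.exp A * Real.cos y ≤ Real.exp A * 1 := by
      gcongr; exact Real.cos_le_one y
    linarith
  have hIic : IntegrableOn (fun ξ : ℝ => wf x ν b (ξ + (0:ℝ) * Complex.I)) (Set.Iic B) := by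
    have hg : IntegrableOn (fun ξ : ℝ => Real.exp (Real.exp B) * Real.exp (b * ξ)) (Set.Iic B) := by
      apply Integrable.const_mul
      have := integrableOn_exp_mul_Iic hb B
      exact this
    refine integrable_line _ hwf 0 _ _ hg measurableSet_Iic (fun ξ hξ => ?_)
    refine (hleft ξ hξ 0 Set.left_mem_uIcc).trans ?_
    rw [← Real.exp_add]
    apply Real.exp_le_exp.2
    have := Real.exp_le_exp.2 (Set.mem_Iic.1 hξ)
    linarith
  have hcau := left_limit _ hwf 0 φ B _ (gumbel_atBot 1 b hb) hleft hIic hIntg.integrableOn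
  have him0 : (∫ ξ in Set.Iic B, wf x ν b (ξ + (0:ℝ) * Complex.I)).im = 0 := by
    have := (Complex.imCLM).integral_comp_comm hIic
    simp only [Complex.imCLM_apply] at this
    rw [← this]
    simp_rw [wf_real_im]
    simp
  have hsplit : (∫ ξ : ℝ, wf x ν b (ξ + φ * Complex.I)) =
      (∫ ξ in Set.Iic B, wf x ν b (ξ + φ * Complex.I)) + ∫ ξ in Set.Ioi B, wf x ν b (ξ + φ * Complex.I) := by
    rw [intervalIntegral.integral_Iic_add_Ioi hIntg.integrableOn hIntg.integrableOn]
  set V := ∫ y in (0:ℝ)..φ, wf x ν b (B + y * Complex.I) with hV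
  set E := Real.exp (-(κ * x * Real.exp (ν * B))) with hE
  have himeq : (∫ ξ : ℝ, wf x ν b (ξ + φ * Complex.I)).im =
      (Complex.I * V).im + (∫ ξ in Set.Ioi B, wf x ν b (ξ + φ * Complex.I)).im := by
    rw [hsplit, Complex.add_im]
    have := congrArg Complex.im hcau
    rw [Complex.add_im, Complex.sub_im, him0, Complex.zero_im] at this
    linarith
  have hVb : ‖V‖ ≤ E * Real.exp (Real.exp B + b * B) * φ := by
    have := intervalIntegral.norm_integral_le_of_norm_le_const (a := 0) (b := φ)
      (f := fun y : ℝ => wf x ν b (B + y * Complex.I)) (C := E * Real.exp (Real.exp B + b * B)) ?_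
    · rwa [sub_zero, abs_of_pos hφ0] at this
    · intro y hy
      rw [norm_wf, hE, ← Real.exp_add]
      apply Real.exp_le_exp.2
      have h4 := hcos y (Set.uIoc_subset_uIcc hy)
      have h5 : x * (Real.exp (ν * B) * κ) ≤ x * (Real.exp (ν * B) * Real.cos (ν * y)) := by gcongr
      have : Real.exp B * Real.cos y ≤ Real.exp B * 1 := by
        gcongr; exact Real.cos_le_one y
      nlinarith
  have hRb : ‖∫ ξ in Set.Ioi B, wf x ν b (ξ + φ * Complex.I)‖ ≤ E * K0 := by
    have hgi := (integrable_gumbel (-Real.cos φ) b hk hb).const_mul E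
    calc _ ≤ ∫ ξ in Set.Ioi B, E * Real.exp (-(-Real.cos φ) * Real.exp ξ + b * ξ) := by
          refine norm_integral_le_of_norm_le hgi.integrableOn ?_
          refine (ae_restrict_iff' measurableSet_Ioi).2 (Filter.Eventually.of_forall fun ξ hξ => ?_)
          rw [norm_wf, hE, ← Real.exp_add]
          apply Real.exp_le_exp.2
          have : Real.exp (ν * B) ≤ Real.exp (ν * ξ) := by
            apply Real.exp_le_exp.2
            exact mul_le_mul_of_nonneg_left (le_of_lt hξ) hν0.le
          have h5 : x * (Real.exp (ν * B) * κ) ≤ x * (Real.exp (ν * ξ) * κ) := by gcongr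
          nlinarith
      _ ≤ ∫ ξ : ℝ, E * Real.exp (-(-Real.cos φ) * Real.exp ξ + b * ξ) := by
          refine setIntegral_le_integral hgi (Filter.Eventually.of_forall fun ξ => ?_)
          positivity
      _ = E * K0 := by rw [integral_const_mul]
  have hE0 : 0 < E := Real.exp_pos _
  have hX0 : 0 < Real.exp (Real.exp B + b * B) := Real.exp_pos _
  rw [himeq, abs_div, abs_of_pos hpi]
  have hA : |(Complex.I * V).im + (∫ ξ in Set.Ioi B, wf x ν b (ξ + φ * Complex.I)).im| ≤
      E * Real.exp (Real.exp B + b * B) * φ + E * K0 := by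
    refine (abs_add_le _ _).trans (add_le_add ?_ ?_)
    · refine (Complex.abs_im_le_norm _).trans ?_
      rw [norm_mul, Complex.norm_I, one_mul]; exact hVb
    · exact (Complex.abs_im_le_norm _).trans hRb
  have hle : ∀ z : ℝ, 0 ≤ z → z / Real.pi ≤ z := fun z hz =>
    div_le_self hz (by linarith [Real.pi_gt_three])
  calc _ ≤ _ := hle _ (abs_nonneg _)
    _ ≤ _ := hA
    _ ≤ _ := by
      have a1 : 0 ≤ E * K0 * Real.exp (Real.exp B + b * B) := by positivity
      have a2 : 0 ≤ E * φ := by positivity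
      nlinarith

/-- main decay estimate for the Wright-type series -/
lemma wright_decay (ν b : ℝ) (hν0 : 0 < ν) (hν1 : ν < 1) (hb : 0 < b) :
    ∃ K κ : ℝ, 0 < K ∧ 0 < κ ∧ ∀ x : ℝ, 0 ≤ x →
      Summable (fun n : ℕ => (-x) ^ n / (n.factorial * Real.Gamma (1 - (b + n * ν)))) ∧
      ∀ B : ℝ,
      |∑' n : ℕ, (-x) ^ n / (n.factorial * Real.Gamma (1 - (b + n * ν)))| ≤
        K * (Real.exp (-(κ * x * Real.exp (ν * B))) * (1 + Real.exp (Real.exp B + b * B))) := by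
  have hpi := Real.pi_pos
  obtain ⟨φ, h1, h2⟩ := exists_between (show Real.pi / 2 < min Real.pi (Real.pi / (2 * ν)) by
    refine lt_min (by linarith) ?_
    rw [div_lt_div_iff₀ (by norm_num) (by positivity)]
    nlinarith)
  have h3 : ν * φ < Real.pi / 2 := by
    have := h2.trans_le (min_le_right _ _)
    rw [lt_div_iff₀ (by positivity)] at this
    linarith
  have h2' := h2.trans_le (min_le_left _ _)
  obtain ⟨K, hK, hKb⟩ := wright_bound ν b φ hν0 hν1 hb h1 h2' h3
  refine ⟨K, Real.cos (ν * φ), hK, Real.cos_pos_of_mem_Ioo ⟨by nlinarith, h3⟩, fun x hx => ?_⟩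
  have hs := wright_hasSum x ν b φ hx hν0 hν1 hb h1 h2'
  refine ⟨hs.summable, fun B => ?_⟩
  rw [hs.tsum_eq]
  exact hKb x hx B


lemma mainardi_one_decay (ν : ℝ) (hν0 : 0 < ν) (hν1 : ν < 1) :
    ∃ C : ℝ, 0 < C ∧ ∀ x : ℝ, 0 ≤ x → |mainardiR ν 1 x| ≤ C * Real.exp (-x / 2) := by
  obtain ⟨K, κ, hK, hκ, h⟩ := wright_decay ν ν hν0 hν1 hν0
  set B := Real.log (1 / (2 * κ)) / ν with hB
  refine ⟨K * (1 + Real.exp (Real.exp B + ν * B)), by positivity, fun x hx => ?_⟩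
  have h1 := (h x hx).2 B
  have e : Real.exp (ν * B) = 1 / (2 * κ) := by
    rw [hB, mul_div_cancel₀ _ hν0.ne', Real.exp_log (by positivity)]
  have e2 : mainardiR ν 1 x = ∑' n : ℕ, (-x) ^ n / (n.factorial * Real.Gamma (1 - (ν + n * ν))) := by
    unfold mainardiR
    congr 1; ext n; congr 3; ring
  rw [e2]
  refine h1.trans (le_of_eq ?_)
  rw [e, show -(κ * x * (1 / (2 * κ))) = -x / 2 by field_simp]
  ring

lemma wright_gauss_decay (ν b : ℝ) (hν0 : 1 / 2 < ν) (hν1 : ν < 1) (hb : 0 < b) (hb1 : b ≤ 1) :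
    ∃ C : ℝ, 0 < C ∧ ∀ x : ℝ, 0 ≤ x →
      Summable (fun n : ℕ => (-x) ^ n / (n.factorial * Real.Gamma (1 - (b + n * ν)))) ∧
      (1 + x) * |∑' n : ℕ, (-x) ^ n / (n.factorial * Real.Gamma (1 - (b + n * ν)))| ≤
        C * Real.exp (-x ^ 2 / 8) := by
  obtain ⟨K, κ, hK, hκ, h⟩ := wright_decay ν b (by linarith) hν1 hb
  have ht : Filter.Tendsto (fun x : ℝ => κ * x ^ (2 * ν - 1)) Filter.atTop Filter.atTop :=
    Filter.Tendsto.const_mul_atTop hκ (tendsto_rpow_atTop (by linarith))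
  obtain ⟨X, hX⟩ := Filter.eventually_atTop.1 ((ht.eventually_ge_atTop 4).and (Filter.eventually_gt_atTop 0))
  refine ⟨2 * K * Real.exp (3 + 4 * X ^ 2), by positivity, fun x hx => ⟨(h x hx).1, ?_⟩⟩
  have h1 := (h x hx).2 (Real.log (1 + x ^ 2))
  have hpos : (0:ℝ) < 1 + x ^ 2 := by positivity
  rw [Real.exp_log hpos] at h1
  have hl0 : 0 ≤ Real.log (1 + x ^ 2) := Real.log_nonneg (by nlinarith)
  have hl1 : Real.log (1 + x ^ 2) ≤ x ^ 2 := by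
    have := Real.log_le_sub_one_of_pos hpos; linarith
  have h2 : 1 + Real.exp (1 + x ^ 2 + b * Real.log (1 + x ^ 2)) ≤ 2 * Real.exp (1 + 2 * x ^ 2) := by
    have a1 : (1:ℝ) ≤ Real.exp (1 + 2 * x ^ 2) := Real.one_le_exp (by positivity)
    have a2 : Real.exp (1 + x ^ 2 + b * Real.log (1 + x ^ 2)) ≤ Real.exp (1 + 2 * x ^ 2) := by
      apply Real.exp_le_exp.2
      nlinarith
    linarith
  have h3 : 1 + x ≤ Real.exp (1 + x ^ 2) := by
    have := Real.add_one_le_exp x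
    refine (by linarith : 1 + x ≤ Real.exp x).trans (Real.exp_le_exp.2 ?_)
    nlinarith
  set R := κ * x * Real.exp (ν * Real.log (1 + x ^ 2)) with hR
  have hR0 : 0 ≤ R := by positivity
  have h4 : 2 + 3 * x ^ 2 - R ≤ 3 + 4 * X ^ 2 - x ^ 2 / 8 := by
    rcases le_total X x with hXx | hXx
    · obtain ⟨h5, h6⟩ := hX x hXx
      have h7 : x ^ (2 * ν) ≤ Real.exp (ν * Real.log (1 + x ^ 2)) := by
        rw [Real.rpow_def_of_pos h6]
        apply Real.exp_le_exp.2
        have : Real.log (x ^ 2) ≤ Real.log (1 + x ^ 2) := Real.log_le_log (by positivity) (by linarith)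
        rw [Real.log_pow] at this
        push_cast at this
        nlinarith
      have h8 : x ^ (2 * ν) = x ^ (2 * ν - 1) * x := by
        rw [← Real.rpow_add_one h6.ne']; congr 1; ring
      have h9 : 4 * x ^ 2 ≤ R := by
        calc 4 * x ^ 2 ≤ (κ * x ^ (2 * ν - 1)) * x ^ 2 := by gcongr
          _ = κ * x * x ^ (2 * ν) := by rw [h8]; ring
          _ ≤ R := by rw [hR]; gcongr
      nlinarith [sq_nonneg X, sq_nonneg x]
    · have : x ^ 2 ≤ X ^ 2 := by gcongr
      nlinarith
  calc _ ≤ Real.exp (1 + x ^ 2) * (K * (Real.exp (-R) * (2 * Real.exp (1 + 2 * x ^ 2)))) := by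
        refine mul_le_mul h3 (h1.trans ?_) (abs_nonneg _) (Real.exp_pos _).le
        gcongr
    _ = 2 * K * Real.exp (2 + 3 * x ^ 2 - R) := by
        rw [show 2 + 3 * x ^ 2 - R = (1 + x ^ 2) + (-R + (1 + 2 * x ^ 2)) by ring, Real.exp_add _ (-R + _),
          Real.exp_add (-R)]; ring
    _ ≤ 2 * K * Real.exp (3 + 4 * X ^ 2 - x ^ 2 / 8) := by gcongr
    _ = _ := by
        rw [mul_assoc (2 * K), ← Real.exp_add]; congr 2; ring

lemma mainardi_two_decay (ν : ℝ) (hν0 : 1 / 2 < ν) (hν1 : ν < 1) :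
    ∃ C : ℝ, 0 < C ∧ ∀ x : ℝ, 0 ≤ x → |mainardiR ν 2 x| ≤ C * Real.exp (-x ^ 2 / 8) := by
  obtain ⟨C1, hC1, h1⟩ := wright_gauss_decay ν ν hν0 hν1 (by linarith) hν1.le
  obtain ⟨C2, hC2, h2⟩ := wright_gauss_decay ν (2 * ν - 1) hν0 hν1 (by linarith) (by linarith)
  have hν : 0 < 1 - ν := by linarith
  refine ⟨(C1 + C2) / (1 - ν), by positivity, fun x hx => ?_⟩
  obtain ⟨s1, b1⟩ := h1 x hx
  obtain ⟨s2, b2⟩ := h2 x hx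
  set S1 := ∑' n : ℕ, (-x) ^ n / (n.factorial * Real.Gamma (1 - (ν + n * ν)))
  set S2 := ∑' n : ℕ, (-x) ^ n / (n.factorial * Real.Gamma (1 - (2 * ν - 1 + n * ν)))
  have t2 : HasSum (fun n : ℕ => n * ν * ((-x) ^ n / (n.factorial * Real.Gamma (2 - (n + 1) * ν))))
      (-ν * x * S2) := by
    have := s2.hasSum.mul_left (-ν * x)
    rw [← hasSum_nat_add_iff' 1]
    simp only [Finset.range_one, Finset.sum_singleton, Nat.cast_zero, zero_mul, sub_zero]
    refine this.congr_fun' fun n => ?_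
    rw [Nat.factorial_succ, show (2 - (((n+1:ℕ):ℝ) + 1) * ν) = 1 - (2 * ν - 1 + n * ν) by push_cast; ring]
    push_cast
    have : (n:ℝ) + 1 ≠ 0 := by positivity
    rw [pow_succ]
    rcases eq_or_ne (Real.Gamma (1 - (2 * ν - 1 + n * ν))) 0 with h0 | h0
    · rw [h0]; simp
    · field_simp
  have t : HasSum (fun n : ℕ => (1 - ν) * ((-x) ^ n / (n.factorial * Real.Gamma (2 - (n + 1) * ν))))
      (S1 + -ν * x * S2) := by
    refine (s1.hasSum.add t2).congr_fun' fun n => ?_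
    rw [show 1 - (ν + n * ν) = 1 - (n + 1) * ν by ring]
    set w := 1 - ((n:ℝ) + 1) * ν with hw
    rw [show 2 - ((n:ℝ) + 1) * ν = w + 1 by rw [hw]; ring]
    have hfac : (n.factorial : ℝ) ≠ 0 := by positivity
    rcases eq_or_ne w 0 with h0 | h0
    · rw [h0]; simp only [Real.Gamma_zero, mul_zero, div_zero, zero_add]
      have : 1 - ν = n * ν := by linarith
      rw [this]
    · rw [Real.Gamma_add_one h0]
      rcases eq_or_ne (Real.Gamma w) 0 with h0' | h0'
      · rw [h0']; simp
      · have : 1 - ν = w + n * ν := by rw [hw]; ring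
        rw [this]
        field_simp
  have e : (1 - ν) * mainardiR ν 2 x = S1 + -ν * x * S2 := by
    rw [← t.tsum_eq, tsum_mul_left]; rfl
  have hb : (1 - ν) * |mainardiR ν 2 x| ≤ (C1 + C2) * Real.exp (-x ^ 2 / 8) := by
    have e' : (1 - ν) * |mainardiR ν 2 x| = |S1 + -ν * x * S2| := by
      rw [← e, abs_mul, abs_of_pos hν]
    rw [e']
    refine (abs_add_le _ _).trans ?_
    rw [add_mul]
    refine add_le_add (le_trans ?_ b1) (le_trans ?_ b2)
    · nlinarith [abs_nonneg S1]
    · rw [abs_mul, abs_mul, abs_neg, abs_of_pos (by linarith : 0 < ν), abs_of_nonneg hx]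
      have := abs_nonneg S2
      gcongr
      nlinarith
  rw [div_mul_eq_mul_div, le_div_iff₀ hν]
  linarith

lemma mainardi_half (x : ℝ) : mainardiR (1 / 2) 1 x = Real.exp (-x ^ 2 / 4) / √Real.pi := by
  have hpi := Real.pi_pos
  have hsq : √Real.pi * √Real.pi = Real.pi := Real.mul_self_sqrt hpi.le
  have hs0 : √Real.pi ≠ 0 := by positivity
  have h1 := (NormedSpace.expSeries_div_hasSum_exp (-x ^ 2 / 4)).div_const (√Real.pi)
  rw [← Real.exp_eq_exp_ℝ] at h1
  have hodd : HasSum (fun m : ℕ => (-x) ^ (2 * m + 1) / (((2 * m + 1).factorial : ℝ) *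
      Real.Gamma (1 - (((2 * m + 1 : ℕ) : ℝ) + 1) * (1 / 2)))) 0 := by
    refine hasSum_zero.congr_fun' fun m => ?_
    have : 1 - (((2 * m + 1 : ℕ) : ℝ) + 1) * (1 / 2) = -(m : ℝ) := by push_cast; ring
    rw [this, Real.Gamma_neg_nat_eq_zero]; simp
  have heven : HasSum (fun m : ℕ => (-x) ^ (2 * m) / (((2 * m).factorial : ℝ) *
      Real.Gamma (1 - (((2 * m : ℕ) : ℝ) + 1) * (1 / 2)))) (Real.exp (-x ^ 2 / 4) / √Real.pi) := by
    refine h1.congr_fun' fun m => ?_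
    have e1 : 1 - (((2 * m : ℕ) : ℝ) + 1) * (1 / 2) = 1 - ((m : ℝ) + 1 / 2) := by push_cast; ring
    have hr := Real.Gamma_mul_Gamma_one_sub ((m : ℝ) + 1 / 2)
    have hsin : Real.sin (Real.pi * ((m:ℝ) + 1 / 2)) = (-1) ^ m := by
      rw [show Real.pi * ((m:ℝ) + 1 / 2) = Real.pi / 2 + m * Real.pi by ring, Real.sin_add_nat_mul_pi]
      simp
    rw [hsin, Real.Gamma_nat_add_half] at hr
    have hf : ((2 * m).factorial : ℝ) = (2 * m - 1).doubleFactorial * (2 ^ m * m.factorial) := by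
      rcases m with _ | k
      · simp
      · have := Nat.factorial_eq_mul_doubleFactorial (2 * k + 1)
        rw [show 2 * (k + 1) = 2 * k + 1 + 1 by ring, this]
        rw [show 2 * k + 1 + 1 = 2 * (k + 1) by ring, Nat.doubleFactorial_two_mul]
        push_cast
        rw [show 2 * (k + 1) - 1 = 2 * k + 1 by omega]
        ring
    rw [e1, hf]
    set g := Real.Gamma (1 - ((m : ℝ) + 1 / 2))
    set d := ((2 * m - 1).doubleFactorial : ℝ) with hd
    have hd0 : d ≠ 0 := by
      rw [hd]; exact_mod_cast (Nat.doubleFactorial_pos _).ne'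
    have hm1 : ((-1:ℝ) ^ m) * (-1) ^ m = 1 := by rw [← mul_pow]; simp
    have hm0 : ((-1:ℝ) ^ m) ≠ 0 := by positivity
    have hg : d * g = √Real.pi * 2 ^ m * (-1) ^ m := by
      have h5 : d * √Real.pi * g * (-1) ^ m = Real.pi * 2 ^ m := by
        rw [eq_div_iff hm0] at hr
        have h6 : Real.pi * 2 ^ m = (d * √Real.pi / 2 ^ m * g * (-1) ^ m) * 2 ^ m := by rw [hr]
        rw [h6]; field_simp
      apply mul_left_cancel₀ hs0
      calc √Real.pi * (d * g) = d * √Real.pi * g * (((-1:ℝ) ^ m) * (-1) ^ m) := by rw [hm1]; ring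
        _ = (d * √Real.pi * g * (-1) ^ m) * (-1) ^ m := by ring
        _ = (√Real.pi * √Real.pi) * 2 ^ m * (-1) ^ m := by rw [h5, hsq]
        _ = _ := by ring
    rw [show d * (2 ^ m * (m.factorial : ℝ)) * g = (d * g) * 2 ^ m * m.factorial by ring, hg]
    rw [show (-x) ^ (2 * m) = (x ^ 2) ^ m by rw [pow_mul, neg_sq], 
      show -x ^ 2 / 4 = -1 * (x ^ 2) / 4 by ring, div_pow, mul_pow, show (4:ℝ) ^ m = 2 ^ m * 2 ^ m by rw [← mul_pow]; norm_num]
    have h2 : (2:ℝ) ^ m ≠ 0 := by positivity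
    have hfac : (m.factorial : ℝ) ≠ 0 := by positivity
    rw [div_div, div_div, div_eq_div_iff (by positivity) (by positivity)]
    linear_combination (-(x ^ 2) ^ m * 2 ^ m * 2 ^ m * m.factorial * √Real.pi) * hm1
  have := HasSum.even_add_odd (f := fun n : ℕ => (-x) ^ n / ((n.factorial : ℝ) *
    Real.Gamma (1 - ((n : ℝ) + 1) * (1 / 2)))) heven hodd
  rw [add_zero] at this
  unfold mainardiR
  exact this.tsum_eq

lemma ceil_le_one {β : ℝ} (h0 : 0 < β) (h1 : β ≤ 1) : ⌈β⌉₊ = 1 := by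
  rw [Nat.ceil_eq_iff one_ne_zero]; simpa using ⟨h0, h1⟩

lemma ceil_gt_one {β : ℝ} (h0 : 1 < β) (h1 : β < 2) : ⌈β⌉₊ = 2 := by
  rw [Nat.ceil_eq_iff two_ne_zero]; norm_num; exact ⟨h0, h1.le⟩

lemma ratio_bdd (β : ℝ) (hβ0 : 0 < β) (hβ2 : β < 2) :
    BddAbove (Set.range fun x : ℝ => greenG β 1 x ^ 2 / refKernel β 1 x) := by
  rcases lt_or_ge β 1 with h1 | h1
  · obtain ⟨C, hC, h⟩ := mainardi_one_decay (β / 2) (by linarith) (by linarith)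
    refine ⟨C ^ 2 / 2, ?_⟩
    rintro _ ⟨x, rfl⟩
    simp only [greenG, refKernel, ceil_le_one hβ0 h1.le, if_pos h1, Real.one_rpow, div_one, mul_one,
      Nat.cast_one]
    have h2 := h |x| (abs_nonneg x)
    rw [div_le_iff₀ (by positivity)]
    rw [mul_pow, ← sq_abs (mainardiR _ _ _)]
    have h3 : |mainardiR (β / 2) 1 (|x|)| ^ 2 ≤ (C * Real.exp (-|x| / 2)) ^ 2 := by gcongr
    rw [mul_pow, ← Real.exp_nat_mul, show ((2:ℕ):ℝ) * (-|x| / 2) = -|x| by push_cast; ring] at h3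
    nlinarith
  · have key : ∃ C : ℝ, 0 < C ∧ ∀ x : ℝ, 0 ≤ x → |mainardiR (β / 2) (⌈β⌉₊ : ℝ) x| ≤ C * Real.exp (-x ^ 2 / 8) := by
      rcases eq_or_lt_of_le h1 with h1' | h1'
      · refine ⟨1 / √Real.pi, by positivity, fun x _ => ?_⟩
        rw [← h1', ceil_le_one one_pos le_rfl, Nat.cast_one, mainardi_half, abs_of_pos (by positivity)]
        rw [div_eq_mul_one_div, mul_comm]
        gcongr ?_ * Real.exp ?_
        nlinarith [sq_nonneg x]
      · rw [ceil_gt_one h1' hβ2]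
        exact mainardi_two_decay (β / 2) (by linarith) (by linarith)
    obtain ⟨C, hC, h⟩ := key
    have hp : 0 < (4 * Real.pi) ^ (-(1 : ℝ) / 2) := by
      have := Real.pi_pos; positivity
    refine ⟨C ^ 2 / (4 * Real.pi) ^ (-(1 : ℝ) / 2), ?_⟩
    rintro _ ⟨x, rfl⟩
    simp only [greenG, refKernel, if_neg (not_lt.2 h1), Real.one_rpow, div_one, mul_one]
    have h2 := h |x| (abs_nonneg x)
    rw [div_le_iff₀ (by positivity)]
    rw [mul_pow, ← sq_abs (mainardiR _ _ _)]
    have h3 : |mainardiR (β / 2) ⌈β⌉₊ (|x|)| ^ 2 ≤ (C * Real.exp (-|x| ^ 2 / 8)) ^ 2 := by gcongr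
    rw [mul_pow, ← Real.exp_nat_mul, show ((2:ℕ):ℝ) * (-|x| ^ 2 / 8) = -x ^ 2 / 4 by push_cast; rw [sq_abs]; ring] at h3
    rw [← mul_assoc, div_mul_cancel₀ _ hp.ne']
    nlinarith [sq_nonneg |mainardiR (β / 2) ⌈β⌉₊ (|x|)|]

theorem beta_real (p q t : ℝ) (hp : 0 < p) (hq : 0 < q) (ht : 0 < t) :
    ∫ s in Set.Ioc (0:ℝ) t, (t - s) ^ (p - 1) * s ^ (q - 1)
      = t ^ (p + q - 1) * (Real.Gamma p * Real.Gamma q / Real.Gamma (p + q)) := by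
  have h1 := Complex.betaIntegral_scaled (q : ℂ) (p : ℂ) ht
  have h2 := Complex.Gamma_mul_Gamma_eq_betaIntegral (s := (q:ℂ)) (t := (p:ℂ)) (by simpa) (by simpa)
  have hG : 0 < Real.Gamma (p + q) := Real.Gamma_pos_of_pos (by linarith)
  rw [intervalIntegral.integral_of_le ht.le] at h1
  have h3 : ∫ x in Set.Ioc (0:ℝ) t, (x:ℂ) ^ ((q:ℂ) - 1) * ((t:ℂ) - x) ^ ((p:ℂ) - 1)
      = ((∫ s in Set.Ioc (0:ℝ) t, (t - s) ^ (p - 1) * s ^ (q - 1) : ℝ) : ℂ) := by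
    rw [← integral_complex_ofReal]
    refine setIntegral_congr_fun measurableSet_Ioc fun s hs => ?_
    have e1 : ((q:ℂ) - 1) = ((q - 1 : ℝ) : ℂ) := by push_cast; rfl
    have e2 : ((p:ℂ) - 1) = ((p - 1 : ℝ) : ℂ) := by push_cast; rfl
    have e3 : ((t:ℂ) - s) = ((t - s : ℝ) : ℂ) := by push_cast; rfl
    rw [e1, e2, e3, ← Complex.ofReal_cpow hs.1.le, ← Complex.ofReal_cpow (by linarith [hs.2]),
      ← Complex.ofReal_mul, mul_comm]
  rw [h3] at h1
  have e4 : ((q:ℂ) + p) = ((p + q : ℝ) : ℂ) := by push_cast; ring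
  have e5 : ((p + q : ℝ) : ℂ) - 1 = ((p + q - 1 : ℝ) : ℂ) := by push_cast; ring
  rw [e4, Complex.Gamma_ofReal, Complex.Gamma_ofReal, Complex.Gamma_ofReal] at h2
  rw [e4, e5, ← Complex.ofReal_cpow ht.le] at h1
  have h4 : Complex.betaIntegral q p = ((Real.Gamma p * Real.Gamma q / Real.Gamma (p + q) : ℝ) : ℂ) := by
    have : ((Real.Gamma (p+q) : ℝ) : ℂ) ≠ 0 := by exact_mod_cast hG.ne'
    push_cast
    field_simp
    linear_combination -h2
  rw [h4, ← Complex.ofReal_mul] at h1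
  exact_mod_cast h1

theorem beta_integrable (p q t : ℝ) (hp : 0 < p) (hq : 0 < q) (ht : 0 < t) :
    IntegrableOn (fun s : ℝ => (t - s) ^ (p - 1) * s ^ (q - 1)) (Set.Ioc (0:ℝ) t) := by
  by_contra h
  have h1 := integral_undef h
  rw [beta_real p q t hp hq ht] at h1
  have := Real.Gamma_pos_of_pos hp
  have := Real.Gamma_pos_of_pos hq
  have := Real.Gamma_pos_of_pos (add_pos hp hq)
  have : 0 < t ^ (p + q - 1) * (Real.Gamma p * Real.Gamma q / Real.Gamma (p + q)) := by positivity
  linarith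

noncomputable def Bn (k Ct α : ℝ) (n : ℕ) (t : ℝ) : ℝ :=
  k ^ (n+1) * Ct ^ n * Real.Gamma α ^ (n+1) / Real.Gamma (((n:ℝ)+1) * α) * t ^ (((n:ℝ)+1) * α - 1)

theorem iter_bound (g L0 : ℝ → ℝ → ℝ) (k Ct α : ℝ) (hα : 0 < α) (hk : 0 ≤ k) (hCt : 0 ≤ Ct)
    (hL0 : ∀ t x, 0 ≤ L0 t x)
    (hL : ∀ t x, 0 < t → L0 t x ≤ k * t ^ (α - 1) * g t x)
    (hIntg : ∀ t s x, 0 < s → s < t → s ≠ t / 2 → Integrable (fun y => g (t - s) (x - y) * g s y))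
    (hconv : ∀ t s x, 0 < s → s < t → s ≠ t / 2 → ∫ y, g (t - s) (x - y) * g s y ≤ Ct * g t x)
    (n : ℕ) : ∀ t x, (0 ≤ iterL L0 n t x) ∧ (0 < t → iterL L0 n t x ≤ Bn k Ct α n t * g t x) := by
  induction n with
  | zero =>
    intro t x
    refine ⟨hL0 t x, fun ht => ?_⟩
    have := hL t x ht
    have hG := (Real.Gamma_pos_of_pos hα).ne'
    simp only [iterL, Bn]
    simpa [hG] using this
  | succ n ih =>
    intro t x
    have hpos : ∀ s y : ℝ, 0 ≤ iterL L0 n (t - s) (x - y) * L0 s y := fun s y =>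
      mul_nonneg (ih _ _).1 (hL0 _ _)
    refine ⟨?_, fun ht => ?_⟩
    · simp only [iterL, stConv]
      exact integral_nonneg fun s => integral_nonneg fun y => hpos s y
    · simp only [iterL, stConv]
      have hp : 0 < ((n:ℝ) + 1) * α := by positivity
      have hGp := Real.Gamma_pos_of_pos hp
      have hGα := Real.Gamma_pos_of_pos hα
      set D : ℝ := k ^ (n+1) * Ct ^ n * Real.Gamma α ^ (n+1) / Real.Gamma (((n:ℝ)+1) * α) with hD
      have hD0 : 0 ≤ D := by positivity
      have key : ∀ᵐ s ∂(volume.restrict (Set.Ioc (0:ℝ) t)),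
          ∫ y : ℝ, iterL L0 n (t - s) (x - y) * L0 s y ≤
            (D * k * Ct * g t x) * ((t - s) ^ (((n:ℝ)+1) * α - 1) * s ^ (α - 1)) := by
        have a1 : ∀ᵐ s ∂(volume.restrict (Set.Ioc (0:ℝ) t)), s ∈ Set.Ioc (0:ℝ) t :=
          ae_restrict_mem measurableSet_Ioc
        have a2 : ∀ᵐ s ∂(volume.restrict (Set.Ioc (0:ℝ) t)), s ≠ t :=
          ae_restrict_of_ae (Measure.ae_ne volume t)
        have a3 : ∀ᵐ s ∂(volume.restrict (Set.Ioc (0:ℝ) t)), s ≠ t / 2 :=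
          ae_restrict_of_ae (Measure.ae_ne volume (t/2))
        filter_upwards [a1, a2, a3] with s hs hst hs2
        have hs' : s < t := lt_of_le_of_ne hs.2 hst
        have hts : 0 < t - s := by linarith
        set w : ℝ := (t - s) ^ (((n:ℝ)+1) * α - 1) with hw
        have hw0 : 0 ≤ w := Real.rpow_nonneg hts.le _
        set v : ℝ := s ^ (α - 1) with hv
        have hv0 : 0 ≤ v := Real.rpow_nonneg hs.1.le _
        calc ∫ y : ℝ, iterL L0 n (t - s) (x - y) * L0 s y
            ≤ ∫ y : ℝ, (D * w * k * v) * (g (t - s) (x - y) * g s y) := by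
              refine integral_mono_of_nonneg (Filter.Eventually.of_forall fun y => hpos s y)
                ((hIntg t s x hs.1 hs' hs2).const_mul _) (Filter.Eventually.of_forall fun y => ?_)
              have b1 := (ih (t - s) (x - y)).2 hts
              have b2 := hL s y hs.1
              calc iterL L0 n (t - s) (x - y) * L0 s y
                  ≤ (Bn k Ct α n (t - s) * g (t - s) (x - y)) * (k * s ^ (α - 1) * g s y) :=
                    mul_le_mul b1 b2 (hL0 _ _) (le_trans (ih _ _).1 b1)
                _ = (D * w * k * v) * (g (t - s) (x - y) * g s y) := by
                    simp only [Bn, hw, hv, hD]; ring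
          _ = (D * w * k * v) * ∫ y : ℝ, (g (t - s) (x - y) * g s y) := integral_const_mul _ _
          _ ≤ (D * w * k * v) * (Ct * g t x) :=
              mul_le_mul_of_nonneg_left (hconv t s x hs.1 hs' hs2) (by positivity)
          _ = _ := by ring
      calc ∫ s in Set.Ioc (0:ℝ) t, ∫ y : ℝ, iterL L0 n (t - s) (x - y) * L0 s y
          ≤ ∫ s in Set.Ioc (0:ℝ) t, (D * k * Ct * g t x) * ((t - s) ^ (((n:ℝ)+1) * α - 1) * s ^ (α - 1)) :=
            integral_mono_of_nonneg
              (Filter.Eventually.of_forall fun s => integral_nonneg fun y => hpos s y)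
              ((beta_integrable _ _ t hp hα ht).const_mul _) key
        _ = (D * k * Ct * g t x) * (t ^ ((((n:ℝ)+1) * α) + α - 1) *
              (Real.Gamma (((n:ℝ)+1) * α) * Real.Gamma α / Real.Gamma (((n:ℝ)+1) * α + α))) := by
            rw [integral_const_mul, beta_real _ _ t hp hα ht]
        _ = Bn k Ct α (n+1) t * g t x := by
            have e : (((n + 1 : ℕ):ℝ) + 1) * α = ((n:ℝ)+1) * α + α := by push_cast; ring
            simp only [Bn, e, hD]
            field_simp
            ring

theorem term_bound (u v : ℝ) (hu : 0 < u) (hv : 0 ≤ v) :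
    u ^ v / Real.Gamma (v + 1) ≤
      2 * (u ^ ⌊v⌋₊ / (⌊v⌋₊.factorial : ℝ) + u ^ (⌊v⌋₊ + 1) / ((⌊v⌋₊ + 1).factorial : ℝ)) := by
  set k := ⌊v⌋₊ with hk
  obtain ⟨θ, hθ⟩ : ∃ θ, θ = v - k := ⟨_, rfl⟩
  have h0 : 0 ≤ θ := by rw [hθ]; linarith [Nat.floor_le hv]
  have h1 : θ < 1 := by rw [hθ]; linarith [Nat.lt_floor_add_one v]
  have hvk : v = k + θ := by rw [hθ]; ring
  have hk1 : (0:ℝ) < (k:ℝ) + 1 := by positivity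
  have hGv : 0 < Real.Gamma (v + 1) := Real.Gamma_pos_of_pos (by linarith)
  have hfac : (0:ℝ) < (k.factorial : ℝ) := by positivity
  have hx : 0 < (k:ℝ) + 1 + θ := by linarith
  -- Gamma lower bound
  have hlow : (k.factorial : ℝ) * ((k:ℝ) + 1) ^ θ ≤ 2 * Real.Gamma (v + 1) := by
    have hlog : Real.Gamma ((k:ℝ) + 2) ≤ Real.Gamma (v + 1) * ((k:ℝ) + 1 + θ) ^ (1 - θ) := by
      rcases h0.eq_or_lt with h | h
      · have : v + 1 = (k:ℝ) + 1 := by rw [hvk, ← h]; ring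
        rw [this, ← h, sub_zero, Real.rpow_one, add_zero]
        have e : (k:ℝ) + 2 = ((k:ℝ) + 1) + 1 := by ring
        rw [e, Real.Gamma_add_one hk1.ne']
        rw [mul_comm]
      · have := Real.Gamma_mul_add_mul_le_rpow_Gamma_mul_rpow_Gamma (s := (k:ℝ) + 1 + θ)
          (t := (k:ℝ) + 1 + θ + 1) (a := θ) (b := 1 - θ) hx (by linarith) h (by linarith) (by ring)
        have e : θ * ((k:ℝ) + 1 + θ) + (1 - θ) * ((k:ℝ) + 1 + θ + 1) = (k:ℝ) + 2 := by ring
        rw [e, Real.Gamma_add_one hx.ne'] at this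
        have hG : 0 < Real.Gamma ((k:ℝ) + 1 + θ) := Real.Gamma_pos_of_pos hx
        rw [Real.mul_rpow hx.le hG.le] at this
        have e2 : v + 1 = (k:ℝ) + 1 + θ := by rw [hvk]; ring
        rw [e2]
        calc _ ≤ _ := this
          _ = (Real.Gamma ((k:ℝ) + 1 + θ) ^ θ * Real.Gamma ((k:ℝ) + 1 + θ) ^ (1 - θ)) * ((k:ℝ) + 1 + θ) ^ (1 - θ) := by ring
          _ = _ := by rw [← Real.rpow_add hG]; norm_num
    have hGk : Real.Gamma ((k:ℝ) + 2) = ((k:ℝ) + 1) * k.factorial := by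
      have e : (k:ℝ) + 2 = ((k:ℝ) + 1) + 1 := by ring
      rw [e, Real.Gamma_add_one hk1.ne', Real.Gamma_nat_eq_factorial]
    have hup : ((k:ℝ) + 1 + θ) ^ (1 - θ) ≤ 2 * ((k:ℝ) + 1) ^ (1 - θ) := by
      calc ((k:ℝ) + 1 + θ) ^ (1 - θ) ≤ (2 * ((k:ℝ) + 1)) ^ (1 - θ) :=
            Real.rpow_le_rpow hx.le (by have : (0:ℝ) ≤ k := by positivity
                                        linarith) (by linarith)
        _ = 2 ^ (1 - θ) * ((k:ℝ) + 1) ^ (1 - θ) := Real.mul_rpow (by norm_num) hk1.le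
        _ ≤ 2 * ((k:ℝ) + 1) ^ (1 - θ) := by
            gcongr
            calc (2:ℝ) ^ (1 - θ) ≤ 2 ^ (1:ℝ) := Real.rpow_le_rpow_of_exponent_le (by norm_num) (by linarith)
              _ = 2 := by norm_num
    have hsplit : ((k:ℝ) + 1) = ((k:ℝ) + 1) ^ θ * ((k:ℝ) + 1) ^ (1 - θ) := by
      rw [← Real.rpow_add hk1]; norm_num
    have hpos : 0 < ((k:ℝ) + 1) ^ (1 - θ) := by positivity
    rw [hGk] at hlog
    have h3 : ((k.factorial : ℝ) * ((k:ℝ) + 1) ^ θ) * ((k:ℝ) + 1) ^ (1 - θ)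
        ≤ (2 * Real.Gamma (v + 1)) * ((k:ℝ) + 1) ^ (1 - θ) := by
      calc ((k.factorial : ℝ) * ((k:ℝ) + 1) ^ θ) * ((k:ℝ) + 1) ^ (1 - θ)
          = (((k:ℝ) + 1) ^ θ * ((k:ℝ) + 1) ^ (1 - θ)) * k.factorial := by ring
        _ = ((k:ℝ) + 1) * k.factorial := by rw [← hsplit]
        _ ≤ _ := hlog
        _ ≤ Real.Gamma (v + 1) * (2 * ((k:ℝ) + 1) ^ (1 - θ)) := by gcongr
        _ = _ := by ring
    exact le_of_mul_le_mul_right h3 hpos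
  have hq : (u / ((k:ℝ) + 1)) ^ θ ≤ 1 + u / ((k:ℝ) + 1) := by
    set w := u / ((k:ℝ) + 1) with hw
    have hw0 : 0 < w := by positivity
    rcases le_total w 1 with h | h
    · have := Real.rpow_le_one hw0.le h h0
      linarith
    · have : w ^ θ ≤ w ^ (1:ℝ) := Real.rpow_le_rpow_of_exponent_le h h1.le
      rw [Real.rpow_one] at this
      linarith
  rw [Real.div_rpow hu.le hk1.le] at hq
  have hkt : 0 < ((k:ℝ) + 1) ^ θ := by positivity
  have huv : u ^ v = u ^ k * u ^ θ := by rw [hvk, Real.rpow_add hu, Real.rpow_natCast]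
  calc u ^ v / Real.Gamma (v + 1) ≤ u ^ v / ((k.factorial : ℝ) * ((k:ℝ) + 1) ^ θ / 2) := by
        apply div_le_div_of_nonneg_left (by positivity) (by positivity) (by linarith)
    _ = 2 * (u ^ k / k.factorial) * (u ^ θ / ((k:ℝ) + 1) ^ θ) := by rw [huv]; field_simp
    _ ≤ 2 * (u ^ k / k.factorial) * (1 + u / ((k:ℝ) + 1)) := by gcongr
    _ = _ := by
        rw [Nat.factorial_succ, pow_succ]; push_cast; field_simp

theorem ml_tail (α u : ℝ) (hα : 1 / 2 ≤ α) (hu : 0 < u) :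
    Summable (fun m : ℕ => u ^ (((m:ℝ) + 2) * α - 1) / Real.Gamma (((m:ℝ) + 2) * α)) ∧
    ∑' m : ℕ, u ^ (((m:ℝ) + 2) * α - 1) / Real.Gamma (((m:ℝ) + 2) * α) ≤ 8 * Real.exp u := by
  set f : ℕ → ℝ := fun m => u ^ (((m:ℝ) + 2) * α - 1) / Real.Gamma (((m:ℝ) + 2) * α) with hf
  set e : ℕ → ℝ := fun j => u ^ j / (j.factorial : ℝ) with he
  have hes : HasSum e (Real.exp u) := by
    rw [Real.exp_eq_exp_ℝ]; exact NormedSpace.expSeries_div_hasSum_exp u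
  have he0 : ∀ j, 0 ≤ e j := fun j => by simp only [he]; positivity
  set F : ℕ → ℝ := fun j => 2 * (e j + e (j + 1)) with hF
  have hF0 : ∀ j, 0 ≤ F j := fun j => by simp only [hF]; linarith [he0 j, he0 (j+1)]
  have hs1 : Summable (fun j => e (j + 1)) := (summable_nat_add_iff 1).2 hes.summable
  have hFs : Summable F := (hes.summable.add hs1).mul_left 2
  have hFt : ∑' j, F j ≤ 4 * Real.exp u := by
    simp only [hF]
    rw [tsum_mul_left, hes.summable.tsum_add hs1, hes.tsum_eq]
    have := hes.summable.tsum_eq_zero_add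
    rw [hes.tsum_eq] at this
    linarith [he0 0]
  set i : ℕ → ℕ := fun m => ⌊((m:ℝ) + 2) * α - 1⌋₊ with hi
  have hv : ∀ m : ℕ, 0 ≤ ((m:ℝ) + 2) * α - 1 := fun m => by
    have : (0:ℝ) ≤ m := by positivity
    nlinarith
  have hfF : ∀ m, f m ≤ F (i m) := fun m => by
    have := term_bound u _ hu (hv m)
    simp only [sub_add_cancel] at this
    exact this
  have hf0 : ∀ m, 0 ≤ f m := fun m => by
    have : 0 < Real.Gamma (((m:ℝ) + 2) * α) := Real.Gamma_pos_of_pos (by linarith [hv m])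
    simp only [hf]; positivity
  have hstep : ∀ m, i m < i (m + 2) := fun m => by
    have : i m + 1 ≤ i (m + 2) := by
      simp only [hi]
      rw [← Nat.floor_add_one (hv m)]
      apply Nat.floor_le_floor
      push_cast
      nlinarith
    omega
  have hinj : ∀ r : ℕ, Function.Injective (fun j : ℕ => i (2 * j + r)) := fun r =>
    (strictMono_nat_of_lt_succ fun j => by
      have := hstep (2 * j + r)
      have e : 2 * (j + 1) + r = 2 * j + r + 2 := by ring
      rw [e]; exact this).injective
  have hpart : ∀ r : ℕ, Summable (fun j : ℕ => f (2 * j + r)) ∧ ∑' j : ℕ, f (2 * j + r) ≤ 4 * Real.exp u := fun r => by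
    have hs : Summable (fun j : ℕ => F (i (2 * j + r))) := hFs.comp_injective (hinj r)
    have hs' : Summable (fun j : ℕ => f (2 * j + r)) :=
      Summable.of_nonneg_of_le (fun j => hf0 _) (fun j => hfF _) hs
    refine ⟨hs', ?_⟩
    calc _ ≤ ∑' j : ℕ, F (i (2 * j + r)) := hs'.tsum_le_tsum (fun j => hfF _) hs
      _ ≤ ∑' j, F j := tsum_comp_le_tsum_of_inj hFs hF0 (hinj r)
      _ ≤ _ := hFt
  have hE := hpart 0
  have hO := hpart 1
  simp only [add_zero] at hE
  have := hE.1.hasSum.even_add_odd hO.1.hasSum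
  refine ⟨this.summable, ?_⟩
  rw [this.tsum_eq]
  linarith [hE.2, hO.2]

theorem sum_bound (k Ct α Υ : ℝ) (hα : 1 / 2 ≤ α) (hk : 0 ≤ k) (hCt : 0 < Ct)
    (hΥ : Υ = (k * Ct * Real.Gamma α) ^ (1 / α)) :
    ∃ C : ℝ, ∀ t : ℝ, 0 < t → Summable (fun n => Bn k Ct α n t) ∧
      ∑' n, Bn k Ct α n t ≤ C * (t ^ (α - 1) + Real.exp (Υ * t)) := by
  have hα0 : 0 < α := by linarith
  have hG : 0 < Real.Gamma α := Real.Gamma_pos_of_pos hα0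
  rcases hk.eq_or_lt with h | hk0
  · refine ⟨0, fun t ht => ?_⟩
    have : ∀ n, Bn k Ct α n t = 0 := fun n => by simp [Bn, ← h]
    simp [this]
  have hΥ0 : 0 < Υ := by rw [hΥ]; positivity
  have hΥα : Υ ^ α = k * Ct * Real.Gamma α := by
    rw [hΥ, ← Real.rpow_mul (by positivity)]; field_simp; simp
  refine ⟨k + 8 * Υ / Ct, fun t ht => ?_⟩
  have hu : 0 < Υ * t := by positivity
  obtain ⟨hs, hle⟩ := ml_tail α (Υ * t) hα hu
  have hB : ∀ m : ℕ, Bn k Ct α (m + 1) t =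
      Υ / Ct * ((Υ * t) ^ (((m:ℝ) + 2) * α - 1) / Real.Gamma (((m:ℝ) + 2) * α)) := fun m => by
    have e : (((m + 1 : ℕ) : ℝ) + 1) = (m:ℝ) + 2 := by push_cast; ring
    have hGm : 0 < Real.Gamma (((m:ℝ) + 2) * α) := Real.Gamma_pos_of_pos (by positivity)
    have e2 : Υ ^ (((m:ℝ) + 2) * α - 1) = (k * Ct * Real.Gamma α) ^ (m + 2) / Υ := by
      rw [Real.rpow_sub_one hΥ0.ne', mul_comm, Real.rpow_mul hΥ0.le, hΥα, ← Real.rpow_natCast]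
      push_cast; rfl
    simp only [Bn, e]
    rw [Real.mul_rpow hΥ0.le ht.le, e2]
    field_simp
    ring
  have hs1 : Summable (fun m => Bn k Ct α (m + 1) t) := by
    simp_rw [hB]; exact hs.mul_left _
  have hS : Summable (fun m => Bn k Ct α m t) := (summable_nat_add_iff (f := fun m => Bn k Ct α m t) 1).1 hs1
  refine ⟨hS, ?_⟩
  rw [hS.tsum_eq_zero_add]
  simp_rw [hB]
  rw [tsum_mul_left]
  have hB0 : Bn k Ct α 0 t = k * t ^ (α - 1) := by
    simp [Bn]; left; field_simp
  rw [hB0]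
  have hexp : 0 < Real.exp (Υ * t) := Real.exp_pos _
  have ht' : 0 < t ^ (α - 1) := by positivity
  have h1 : Υ / Ct * ∑' m : ℕ, (Υ * t) ^ (((m:ℝ) + 2) * α - 1) / Real.Gamma (((m:ℝ) + 2) * α)
      ≤ Υ / Ct * (8 * Real.exp (Υ * t)) := by gcongr
  have h2 : 0 < k * Real.exp (Υ * t) := by positivity
  have h3 : 0 < 8 * Υ / Ct * t ^ (α - 1) := by positivity
  calc _ ≤ k * t ^ (α - 1) + Υ / Ct * (8 * Real.exp (Υ * t)) := by linarith
    _ ≤ k * t ^ (α - 1) + Υ / Ct * (8 * Real.exp (Υ * t)) + (k * Real.exp (Υ * t) + 8 * Υ / Ct * t ^ (α - 1)) := by linarith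
    _ = _ := by ring

theorem key_exp (p q a b x : ℝ) (hp : 0 < p) (hq : 0 < q) (hpa : p = 1 - a) (hqb : q = 1 - b)
    (hb : 0 < b) (hab : b < a) :
    a * Real.exp (-x * (p / a)) - b * Real.exp (-x * (q / b)) ≤
      Real.exp (-(p * b * Real.log (q / p) / (a - b))) * ((a - b) / q) := by
  have ha : 0 < a := by linarith
  have hd : 0 < a - b := by linarith
  set X : ℝ := a * b * Real.log (q / p) / (a - b) with hX
  set d : ℝ := x - X with hdd
  set w : ℝ := p * b / (a * q) with hw
  have hw0 : 0 ≤ w := by positivity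
  have hw1 : w ≤ 1 := by
    rw [hw, div_le_one (by positivity), hpa, hqb]; nlinarith
  have hconv : Real.exp (-d * (p / a)) ≤ (1 - w) + w * Real.exp (-d * (q / b)) := by
    have := convexOn_exp.2 (Set.mem_univ (0:ℝ)) (Set.mem_univ (-d * (q / b)))
      (show (0:ℝ) ≤ 1 - w by linarith) hw0 (by ring)
    simp only [smul_eq_mul, mul_zero, zero_add, Real.exp_zero, mul_one] at this
    have e : w * (-d * (q / b)) = -d * (p / a) := by rw [hw]; field_simp
    rw [e] at this
    exact this
  set E : ℝ := Real.exp (-(p * b * Real.log (q / p) / (a - b))) with hE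
  have hE0 : 0 < E := Real.exp_pos _
  have e1 : Real.exp (-x * (p / a)) = E * Real.exp (-d * (p / a)) := by
    rw [hE, ← Real.exp_add]; congr 1; rw [hdd, hX]; field_simp; ring
  have e2 : Real.exp (-x * (q / b)) = (p / q) * E * Real.exp (-d * (q / b)) := by
    have hl : p / q = Real.exp (-Real.log (q / p)) := by
      rw [Real.exp_neg, Real.exp_log (by positivity)]; field_simp
    rw [hE, hl, ← Real.exp_add, ← Real.exp_add]; congr 1; rw [hdd, hX]
    have : p = q - (a - b) := by rw [hpa, hqb]; ring
    generalize Real.log (q / p) = l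
    rw [this]
    have h3 : b = 1 - q := by rw [hqb]; ring
    field_simp
    rw [h3]
    ring
  rw [e1, e2]
  have e3 : a * w = b * (p / q) := by rw [hw]; field_simp
  have e4 : a - a * w = (a - b) / q := by
    rw [e3]; field_simp; rw [hpa, hqb]; ring
  calc a * (E * Real.exp (-d * (p / a))) - b * ((p / q) * E * Real.exp (-d * (q / b)))
      ≤ a * (E * ((1 - w) + w * Real.exp (-d * (q / b)))) - b * ((p / q) * E * Real.exp (-d * (q / b))) := by
        gcongr
    _ = E * (a - a * w) + E * Real.exp (-d * (q / b)) * (a * w - b * (p / q)) := by ring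
    _ = E * ((a - b) / q) := by rw [e4, e3]; ring

set_option maxHeartbeats 1000000 in
theorem key_const (a b τ m : ℝ) (hb : 0 < b) (hbτ : b ≤ τ) (hτa : τ ≤ a) (hab : b < a) (ha : a < 1)
    (hsum : a + b ≤ 2 * τ) (hτ : 1 / 2 ≤ τ ^ 2) (hm : 2 * b * (1 - a) / ((1 - a) + (1 - b)) ≤ m) :
    Real.exp (τ - m) * (1 - τ) ≤ (1 - b) * (a + b) := by
  have hτ1 : τ < 1 := by linarith
  have hτ7 : 0.707 < τ := by nlinarith
  obtain ⟨δ, hδ⟩ : ∃ δ, δ = 1 - τ := ⟨_, rfl⟩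
  have hδ0 : 0 < δ := by linarith
  have hδ1 : δ < 0.293 := by linarith
  have hτe : τ = 1 - δ := by linarith
  obtain ⟨k, hk⟩ : ∃ k, k = (τ - b) / δ := ⟨_, rfl⟩
  have hkb : k * δ = τ - b := by rw [hk]; field_simp
  have hk0 : 0 ≤ k := by rw [hk]; apply div_nonneg <;> linarith
  have hbe : b = τ - k * δ := by linarith
  have hq : 1 - b = δ * (1 + k) := by rw [hbe, hτe]; ring
  have hp : δ * (1 - k) ≤ 1 - a := by nlinarith
  rw [← hδ]
  rcases le_or_gt k 1 with h1 | h1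
  · have hm2 : b * (1 - k) ≤ m := by
      refine le_trans ?_ hm
      rw [le_div_iff₀ (by linarith), hq]
      have : 0 ≤ b * ((1 - a) - δ * (1 - k)) := mul_nonneg hb.le (by linarith)
      have h2 : (1-k) * ((1 - a) + δ * (1 + k)) ≤ 2 * (1 - a) := by nlinarith
      nlinarith
    obtain ⟨w, hw⟩ : ∃ w, w = k - k ^ 2 * δ := ⟨_, rfl⟩
    have hw0 : 0 ≤ w := by rw [hw]; nlinarith
    have hw1 : w ≤ 1 := by rw [hw]; nlinarith [mul_nonneg (sq_nonneg k) hδ0.le]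
    have hle : τ - m ≤ w := by
      have : b * (1 - k) = τ - w := by rw [hw, hbe, hτe]; ring
      linarith
    have hexp : Real.exp w ≤ 1 + w + w ^ 2 := by
      have := Real.abs_exp_sub_one_sub_id_le (x := w) (by rw [abs_of_nonneg hw0]; exact hw1)
      have := (abs_le.1 this).2
      linarith
    have hpoly : 1 + w + w ^ 2 ≤ (1 + k) * (2 - (2 + k) * δ) := by
      rw [hw]
      have c1 : 0 ≤ k ^ 3 * δ * (0.293 - k * δ) := by
        have : k * δ ≤ 0.293 := by nlinarith
        have : 0 ≤ 0.293 - k * δ := by linarith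
        positivity
      have c2 : 0 ≤ (2 + 3 * k - 1.707 * k ^ 3) * (0.293 - δ) := by
        apply mul_nonneg _ (by linarith)
        have : k ^ 3 ≤ 1 := pow_le_one₀ hk0 h1
        linarith
      have c3 : 0 ≤ 0.414 + 0.121 * k - k ^ 2 + 0.5 * k ^ 3 := by
        nlinarith [mul_nonneg hk0 (sub_nonneg.2 h1), mul_nonneg hk0 (sq_nonneg (1 - k)), sq_nonneg (1-k)]
      nlinarith [pow_nonneg hk0 3]
    have hsum2 : 2 - (2 + k) * δ ≤ a + b := by rw [hbe]; nlinarith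
    calc Real.exp (τ - m) * δ ≤ Real.exp w * δ := by gcongr
      _ ≤ ((1 + k) * (2 - (2 + k) * δ)) * δ := by gcongr; linarith
      _ ≤ ((1 + k) * (a + b)) * δ := by gcongr
      _ = _ := by rw [hq]; ring
  · have hm0 : 0 ≤ m := by
      refine le_trans ?_ hm
      apply div_nonneg _ (by linarith)
      apply mul_nonneg (by linarith) (by linarith)
    have hexp : Real.exp τ * (1 + δ) ≤ 2.7183 := by
      have h2 : 1 + δ ≤ Real.exp δ := by linarith [Real.add_one_le_exp δ]
      calc Real.exp τ * (1 + δ) ≤ Real.exp τ * Real.exp δ := by gcongr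
        _ = Real.exp 1 := by rw [← Real.exp_add, hδ]; congr 1; ring
        _ ≤ 2.7183 := by linarith [Real.exp_one_lt_d9]
    have hbd : b ≤ τ - δ := by nlinarith
    have hmain : 2.7183 * δ ≤ ((1 - b) * (τ + b)) * (1 + δ) := by
      have g1 : τ + b * (2 * δ - τ) ≤ (1 - b) * (τ + b) := by
        have : b * b ≤ b * (τ - δ) := mul_le_mul_of_nonneg_left hbd hb.le
        rw [hτe] at this ⊢
        linarith
      have g2 : 2.7183 * δ ≤ (τ + b * (2 * δ - τ)) * (1 + δ) := by
        rcases le_or_gt 0 (2 * δ - τ) with h | h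
        · have r1 : 0 ≤ (b * (2 * δ - τ)) * (1 + δ) := by positivity
          have r2 : 2.7183 * δ ≤ τ * (1 + δ) := by
            have r4 : δ * δ ≤ 0.293 * δ := mul_le_mul_of_nonneg_right hδ1.le hδ0.le
            rw [hτe]
            norm_num at r4 hδ1 ⊢
            linarith
          linarith
        · have r1 : (τ - δ) * (2 * δ - τ) ≤ b * (2 * δ - τ) :=
            mul_le_mul_of_nonpos_right hbd h.le
          have r2 : 2.7183 ≤ 4 - 2 * δ - 6 * δ ^ 2 := by
            have r4 : δ ^ 2 ≤ 0.293 ^ 2 := pow_le_pow_left₀ hδ0.le hδ1.le 2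
            norm_num at r4 hδ1 ⊢
            linarith
          have r3 : 2.7183 * δ ≤ (4 - 2 * δ - 6 * δ ^ 2) * δ :=
            mul_le_mul_of_nonneg_right r2 hδ0.le
          calc 2.7183 * δ ≤ (4 - 2 * δ - 6 * δ ^ 2) * δ := r3
            _ = (τ + (τ - δ) * (2 * δ - τ)) * (1 + δ) := by rw [hτe]; ring
            _ ≤ _ := by gcongr
      exact g2.trans (mul_le_mul_of_nonneg_right g1 (by linarith))
    have h5 : Real.exp τ * δ * (1 + δ) ≤ ((1 - b) * (τ + b)) * (1 + δ) := by
      have := mul_le_mul_of_nonneg_right hexp hδ0.le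
      linarith
    have h6 : Real.exp τ * δ ≤ (1 - b) * (τ + b) := le_of_mul_le_mul_right h5 (by linarith)
    calc Real.exp (τ - m) * δ ≤ Real.exp τ * δ := by gcongr; linarith
      _ ≤ (1 - b) * (τ + b) := h6
      _ ≤ _ := by gcongr; linarith

theorem key_ineq (a b τ x : ℝ) (hb : 0 < b) (hbτ : b ≤ τ) (hτa : τ ≤ a) (hab : b < a) (ha : a < 1)
    (hsum : a + b ≤ 2 * τ) (hτ : 1 / 2 ≤ τ ^ 2) :
    (a * Real.exp (-x / a) - b * Real.exp (-x / b)) / (a ^ 2 - b ^ 2) ≤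
      Real.exp (-τ) / (1 - τ) * Real.exp (-x) := by
  have ha0 : 0 < a := by linarith
  have hp : 0 < 1 - a := by linarith
  have hq : 0 < 1 - b := by linarith
  have hd : 0 < a - b := by linarith
  have hτ1 : 0 < 1 - τ := by linarith
  have h1 := key_exp (1 - a) (1 - b) a b x hp hq rfl rfl hb hab
  set m : ℝ := (1 - a) * b * Real.log ((1 - b) / (1 - a)) / (a - b) with hm
  have hlog : 2 * (a - b) / ((1 - a) + (1 - b)) ≤ Real.log ((1 - b) / (1 - a)) := by
    have h := Real.le_log_one_add_of_nonneg (x := (a - b) / (1 - a)) (by positivity)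
    have e1 : 1 + (a - b) / (1 - a) = (1 - b) / (1 - a) := by field_simp; ring
    have e2 : 2 * ((a - b) / (1 - a)) / ((a - b) / (1 - a) + 2) = 2 * (a - b) / ((1 - a) + (1 - b)) := by
      have : 0 < (1 - a) + (1 - b) := by linarith
      have : 0 < (a - b) / (1 - a) + 2 := by positivity
      rw [div_eq_div_iff (by positivity) (by positivity)]
      field_simp
      ring
    rwa [e1, e2] at h
  have hm1 : 2 * b * (1 - a) / ((1 - a) + (1 - b)) ≤ m := by
    rw [hm]
    calc 2 * b * (1 - a) / ((1 - a) + (1 - b)) = (1 - a) * b * (2 * (a - b) / ((1 - a) + (1 - b))) / (a - b) := by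
          have : 0 < (1 - a) + (1 - b) := by linarith
          field_simp
      _ ≤ _ := by gcongr
  have h2 := key_const a b τ m hb hbτ hτa hab ha hsum hτ hm1
  have e1 : Real.exp (-x / a) = Real.exp (-x) * Real.exp (-x * ((1 - a) / a)) := by
    rw [← Real.exp_add]; congr 1; field_simp; ring
  have e2 : Real.exp (-x / b) = Real.exp (-x) * Real.exp (-x * ((1 - b) / b)) := by
    rw [← Real.exp_add]; congr 1; field_simp; ring
  have hab2 : 0 < a ^ 2 - b ^ 2 := by nlinarith
  rw [e1, e2, div_le_iff₀ hab2]
  have h3 : Real.exp (-m) * (1 - τ) ≤ Real.exp (-τ) * ((1 - b) * (a + b)) := by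
    have : Real.exp (-m) = Real.exp (-τ) * Real.exp (τ - m) := by
      rw [← Real.exp_add]; congr 1; ring
    rw [this, mul_assoc]; gcongr
  have h4 : Real.exp (-m) * ((a - b) / (1 - b)) ≤ Real.exp (-τ) / (1 - τ) * (a ^ 2 - b ^ 2) := by
    rw [mul_div_assoc', div_mul_eq_mul_div, div_le_div_iff₀ hq hτ1]
    nlinarith
  calc a * (Real.exp (-x) * Real.exp (-x * ((1 - a) / a))) - b * (Real.exp (-x) * Real.exp (-x * ((1 - b) / b)))
      = Real.exp (-x) * (a * Real.exp (-x * ((1 - a) / a)) - b * Real.exp (-x * ((1 - b) / b))) := by ring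
    _ ≤ Real.exp (-x) * (Real.exp (-τ) / (1 - τ) * (a ^ 2 - b ^ 2)) := by
        gcongr; exact h1.trans h4
    _ = _ := by ring

theorem laplace_conv_nonneg (a b x : ℝ) (ha : 0 < a) (hb : 0 < b) (hab : a ≠ b) (hx : 0 ≤ x) :
    Integrable (fun y : ℝ => Real.exp (-|x - y| / a) * Real.exp (-|y| / b)) ∧
    ∫ y : ℝ, Real.exp (-|x - y| / a) * Real.exp (-|y| / b) =
      2 * a * b * ((a * Real.exp (-x / a) - b * Real.exp (-x / b)) / (a ^ 2 - b ^ 2)) := by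
  set f : ℝ → ℝ := fun y : ℝ => Real.exp (-|x - y| / a) * Real.exp (-|y| / b) with hf
  have hP : 0 < 1 / a + 1 / b := by positivity
  have hM : 1 / a - 1 / b ≠ 0 := by
    intro h
    apply hab
    have : 1 / a = 1 / b := by linarith
    field_simp at this
    exact this.symm
  have c1 : Set.EqOn f (fun y => Real.exp (-x / a) * Real.exp ((1 / a + 1 / b) * y)) (Set.Iic 0) := by
    intro y hy
    have hy : y ≤ 0 := hy
    simp only [hf]
    rw [abs_of_nonneg (show 0 ≤ x - y by linarith), abs_of_nonpos hy, ← Real.exp_add, ← Real.exp_add]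
    congr 1; field_simp; ring
  have c2 : Set.EqOn f (fun y => Real.exp (-x / a) * Real.exp ((1 / a - 1 / b) * y)) (Set.Ioc 0 x) := by
    intro y hy
    simp only [hf]
    rw [abs_of_nonneg (show 0 ≤ x - y by linarith [hy.2]), abs_of_nonneg hy.1.le, ← Real.exp_add, ← Real.exp_add]
    congr 1; field_simp; ring
  have c3 : Set.EqOn f (fun y => Real.exp (x / a) * Real.exp (-(1 / a + 1 / b) * y)) (Set.Ioi x) := by
    intro y hy
    have hy : x < y := hy
    simp only [hf]
    rw [abs_of_nonpos (show x - y ≤ 0 by linarith), abs_of_nonneg (show 0 ≤ y by linarith), ← Real.exp_add, ← Real.exp_add]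
    congr 1; field_simp; ring
  have i1 : IntegrableOn f (Set.Iic 0) :=
    IntegrableOn.congr_fun ((integrableOn_exp_mul_Iic hP 0).const_mul _) c1.symm measurableSet_Iic
  have i2 : IntegrableOn f (Set.Ioc 0 x) := by
    have hcont : Continuous f := by simp only [hf]; fun_prop
    exact (hcont.integrableOn_Icc (a := 0) (b := x)).mono_set Set.Ioc_subset_Icc_self
  have i3 : IntegrableOn f (Set.Ioi x) :=
    IntegrableOn.congr_fun ((integrableOn_exp_mul_Ioi (by linarith) x).const_mul _) c3.symm measurableSet_Ioi
  have hU1 : Set.Ioc 0 x ∪ Set.Ioi x = Set.Ioi (0:ℝ) := Set.Ioc_union_Ioi_eq_Ioi hx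
  have i4 : IntegrableOn f (Set.Ioi 0) := by rw [← hU1]; exact i2.union i3
  have hU2 : Set.Iic (0:ℝ) ∪ Set.Ioi 0 = Set.univ := Set.Iic_union_Ioi
  have i5 : Integrable f := by
    rw [← integrableOn_univ, ← hU2]; exact i1.union i4
  refine ⟨i5, ?_⟩
  have v1 : ∫ y in Set.Iic (0:ℝ), f y = Real.exp (-x / a) * (1 / (1 / a + 1 / b)) := by
    rw [setIntegral_congr_fun measurableSet_Iic c1, integral_const_mul, integral_exp_mul_Iic hP]
    simp
  have v2 : ∫ y in Set.Ioc (0:ℝ) x, f y = (Real.exp (-x / b) - Real.exp (-x / a)) / (1 / a - 1 / b) := by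
    rw [setIntegral_congr_fun measurableSet_Ioc c2, integral_const_mul,
      ← intervalIntegral.integral_of_le hx, intervalIntegral.integral_comp_mul_left (fun y => Real.exp y) hM,
      integral_exp]
    have : Real.exp (-x / b) = Real.exp (-x / a) * Real.exp ((1 / a - 1 / b) * x) := by
      rw [← Real.exp_add]; congr 1; field_simp; ring
    rw [this, mul_zero, Real.exp_zero, smul_eq_mul]
    ring
  have v3 : ∫ y in Set.Ioi x, f y = Real.exp (-x / b) * (1 / (1 / a + 1 / b)) := by
    rw [setIntegral_congr_fun measurableSet_Ioi c3, integral_const_mul, integral_exp_mul_Ioi (by linarith)]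
    have : Real.exp (-x / b) = Real.exp (x / a) * Real.exp (-(1 / a + 1 / b) * x) := by
      rw [← Real.exp_add]; congr 1; field_simp; ring
    rw [this, neg_div_neg_eq]
    ring
  have d1 : Disjoint (Set.Ioc 0 x) (Set.Ioi x) := by
    rw [Set.disjoint_left]; intro y hy hy'; exact absurd hy' (not_lt.2 hy.2)
  have v4 : ∫ y in Set.Ioi (0:ℝ), f y = (∫ y in Set.Ioc (0:ℝ) x, f y) + ∫ y in Set.Ioi x, f y := by
    rw [← hU1, setIntegral_union d1 measurableSet_Ioi i2 i3]
  have v5 : ∫ y, f y = (∫ y in Set.Iic (0:ℝ), f y) + ∫ y in Set.Ioi (0:ℝ), f y := by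
    rw [intervalIntegral.integral_Iic_add_Ioi i1 i4]
  rw [v5, v4, v1, v2, v3]
  have hs : a ^ 2 - b ^ 2 ≠ 0 := by
    have : a ^ 2 - b ^ 2 = (a - b) * (a + b) := by ring
    rw [this]
    exact mul_ne_zero (sub_ne_zero.2 hab) (by positivity)
  have q1 : 1 / (1 / a + 1 / b) = a * b * (a - b) / (a ^ 2 - b ^ 2) := by
    rw [eq_div_iff hs]; field_simp; ring
  have q2 : 1 / (1 / a - 1 / b) = - (a * b * (a + b)) / (a ^ 2 - b ^ 2) := by
    rw [div_eq_div_iff hM hs]; field_simp; ring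
  rw [div_eq_mul_one_div (Real.exp (-x / b) - Real.exp (-x / a)), q1, q2]
  field_simp
  ring

theorem laplace_conv (a b x : ℝ) (ha : 0 < a) (hb : 0 < b) (hab : a ≠ b) :
    Integrable (fun y : ℝ => Real.exp (-|x - y| / a) * Real.exp (-|y| / b)) ∧
    ∫ y : ℝ, Real.exp (-|x - y| / a) * Real.exp (-|y| / b) =
      2 * a * b * ((a * Real.exp (-|x| / a) - b * Real.exp (-|x| / b)) / (a ^ 2 - b ^ 2)) := by
  rcases le_total 0 x with hx | hx
  · rw [abs_of_nonneg hx]; exact laplace_conv_nonneg a b x ha hb hab hx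
  · rw [abs_of_nonpos hx]
    obtain ⟨h1, h2⟩ := laplace_conv_nonneg a b (-x) ha hb hab (by linarith)
    have e : (fun y : ℝ => Real.exp (-|x - y| / a) * Real.exp (-|y| / b)) =
        fun y => (fun y : ℝ => Real.exp (-|-x - y| / a) * Real.exp (-|y| / b)) (-y) := by
      funext y
      have : |x - y| = |-x - -y| := by rw [← abs_neg]; congr 1; ring
      simp only [this, abs_neg]
    rw [e]
    exact ⟨h1.comp_neg, by rw [integral_neg_eq_self (fun y : ℝ => Real.exp (-|-x - y| / a) * Real.exp (-|y| / b))]; exact h2⟩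

theorem tau_ineq (h u : ℝ) (x : ℝ) (hh : 0 < h) (hh2 : h < 1 / 2) (hu0 : 0 < u) (hu : u < 1 / 2) :
    ((1 - u) ^ h * Real.exp (-x / (1 - u) ^ h) - u ^ h * Real.exp (-x / u ^ h)) /
      (((1 - u) ^ h) ^ 2 - (u ^ h) ^ 2) ≤
      Real.exp (-(2:ℝ) ^ (-h)) / (1 - (2:ℝ) ^ (-h)) * Real.exp (-x) := by
  have e : (2:ℝ) ^ (-h) = (1 / 2 : ℝ) ^ h := by
    rw [one_div, Real.inv_rpow (by norm_num), Real.rpow_neg (by norm_num)]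
  rw [e]
  apply key_ineq
  · positivity
  · exact Real.rpow_le_rpow hu0.le hu.le hh.le
  · exact Real.rpow_le_rpow (by norm_num) (by linarith) hh.le
  · exact Real.rpow_lt_rpow hu0.le (by linarith) hh
  · exact Real.rpow_lt_one (by linarith) (by linarith) hh
  · have := (Real.concaveOn_rpow hh.le (by linarith)).2 (x := 1 - u) (y := u)
      (show (0:ℝ) ≤ 1 - u by linarith) (show (0:ℝ) ≤ u from hu0.le)
      (show (0:ℝ) ≤ 1 / 2 by norm_num) (show (0:ℝ) ≤ 1 / 2 by norm_num) (by norm_num)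
    simp only [smul_eq_mul] at this
    have e2 : (1 / 2 : ℝ) * (1 - u) + 1 / 2 * u = 1 / 2 := by ring
    rw [e2] at this
    linarith
  · rw [← Real.rpow_natCast, ← Real.rpow_mul (by norm_num)]
    calc (1 / 2 : ℝ) = (1 / 2 : ℝ) ^ (1:ℝ) := by norm_num
      _ ≤ _ := Real.rpow_le_rpow_of_exponent_ge (by norm_num) (by norm_num) (by push_cast; linarith)

theorem conv_lt_one (β t s x : ℝ) (hβ0 : 0 < β) (hβ : β < 1) (hs : 0 < s) (hst : s < t) (hs2 : s ≠ t / 2) :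
    Integrable (fun y => refKernel β (t - s) (x - y) * refKernel β s y) ∧
    ∫ y, refKernel β (t - s) (x - y) * refKernel β s y ≤
      (2 : ℝ) ^ (β / 2) / ((2 : ℝ) ^ (β / 2) - 1) * Real.exp (-(2 : ℝ) ^ (-(β / 2))) * refKernel β t x := by
  simp only [refKernel, if_pos hβ]
  obtain ⟨h, hh⟩ : ∃ h, h = β / 2 := ⟨_, rfl⟩
  rw [← hh]
  have hh0 : 0 < h := by linarith
  have hh2 : h < 1 / 2 := by linarith
  have hts : 0 < t - s := by linarith
  have ht : 0 < t := by linarith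
  set a : ℝ := (t - s) ^ h with ha
  set b : ℝ := s ^ h with hb
  set c : ℝ := t ^ h with hc
  have ha0 : 0 < a := by positivity
  have hb0 : 0 < b := by positivity
  have hc0 : 0 < c := by positivity
  have hab : a ≠ b := by
    intro hE
    have := (Real.rpow_left_inj hts.le hs.le hh0.ne').1 hE
    apply hs2; linarith
  obtain ⟨h1, h2⟩ := laplace_conv a b x ha0 hb0 hab
  have e : (fun y => 1 / (2 * a) * Real.exp (-|x - y| / a) * (1 / (2 * b) * Real.exp (-|y| / b))) =
      fun y => (1 / (4 * a * b)) * (Real.exp (-|x - y| / a) * Real.exp (-|y| / b)) := by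
    funext y; field_simp; ring
  rw [e]
  refine ⟨h1.const_mul _, ?_⟩
  rw [integral_const_mul, h2]
  have key : ∀ u X : ℝ, 0 < u → u < 1 → u ≠ 1 / 2 →
      ((1 - u) ^ h * Real.exp (-X / (1 - u) ^ h) - u ^ h * Real.exp (-X / u ^ h)) /
      (((1 - u) ^ h) ^ 2 - (u ^ h) ^ 2) ≤
      Real.exp (-(2:ℝ) ^ (-h)) / (1 - (2:ℝ) ^ (-h)) * Real.exp (-X) := by
    intro u X hu0 hu1 hu2
    rcases lt_or_gt_of_ne hu2 with hlt | hgt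
    · exact tau_ineq h u X hh0 hh2 hu0 hlt
    · have := tau_ineq h (1 - u) X hh0 hh2 (by linarith) (by linarith)
      rw [sub_sub_cancel] at this
      refine le_trans (le_of_eq ?_) this
      rw [← neg_div_neg_eq, neg_sub, neg_sub]
  have hk := key (s / t) (|x| / c) (by positivity) (by rw [div_lt_one ht]; exact hst) (by
    intro hE; apply hs2; field_simp at hE; linarith)
  have e1 : (1 - s / t) ^ h = a / c := by
    rw [ha, hc, ← Real.div_rpow hts.le ht.le]; congr 1; field_simp
  have e2 : (s / t) ^ h = b / c := by
    rw [hb, hc, ← Real.div_rpow hs.le ht.le]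
  have e3 : -(|x| / c) / (a / c) = -|x| / a := by field_simp
  have e4 : -(|x| / c) / (b / c) = -|x| / b := by field_simp
  rw [e1, e2, e3, e4] at hk
  have hr : 1 < (2:ℝ) ^ h := Real.one_lt_rpow (by norm_num) hh0
  have e5 : Real.exp (-(2:ℝ) ^ (-h)) / (1 - (2:ℝ) ^ (-h)) =
      (2 : ℝ) ^ h / ((2 : ℝ) ^ h - 1) * Real.exp (-(2 : ℝ) ^ (-h)) := by
    generalize Real.exp (-(2:ℝ) ^ (-h)) = E
    rw [Real.rpow_neg (by norm_num)]
    have : (2:ℝ) ^ h - 1 ≠ 0 := by linarith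
    field_simp
  rw [e5] at hk
  have hab2 : a ^ 2 - b ^ 2 ≠ 0 := by
    have : a ^ 2 - b ^ 2 = (a - b) * (a + b) := by ring
    rw [this]
    exact mul_ne_zero (sub_ne_zero.2 hab) (by positivity)
  have e6 : (a / c * Real.exp (-|x| / a) - b / c * Real.exp (-|x| / b)) / ((a / c) ^ 2 - (b / c) ^ 2)
      = c * ((a * Real.exp (-|x| / a) - b * Real.exp (-|x| / b)) / (a ^ 2 - b ^ 2)) := by
    have : (a / c) ^ 2 - (b / c) ^ 2 = (a ^ 2 - b ^ 2) / c ^ 2 := by field_simp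
    rw [this]
    field_simp
  rw [e6] at hk
  set Q := (a * Real.exp (-|x| / a) - b * Real.exp (-|x| / b)) / (a ^ 2 - b ^ 2) with hQ
  have e7 : 1 / (4 * a * b) * (2 * a * b * Q) = 1 / (2 * c) * (c * Q) := by field_simp; norm_num
  rw [e7]
  refine (mul_le_mul_of_nonneg_left hk (show 0 ≤ 1 / (2 * c) by positivity)).trans (le_of_eq ?_)
  rw [neg_div]; ring

theorem real_pow_mean {a b p : ℝ} (ha : 0 ≤ a) (hb : 0 ≤ b) (hp : 1 ≤ p) :
    (a + b) ^ p ≤ (2:ℝ) ^ (p - 1) * (a ^ p + b ^ p) := by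
  lift a to NNReal using ha
  lift b to NNReal using hb
  exact_mod_cast NNReal.rpow_add_le_mul_rpow_add_rpow a b hp

theorem gauss_sq (A B x y : ℝ) (hA : 0 < A) (hB : 0 < B) :
    Real.exp (-(x - y) ^ 2 / (4 * A)) * Real.exp (-y ^ 2 / (4 * B)) =
      Real.exp (-x ^ 2 / (4 * (A + B))) *
        Real.exp (-((A + B) / (4 * A * B)) * (y - B * x / (A + B)) ^ 2) := by
  have hAB : 0 < A + B := by positivity
  rw [← Real.exp_add, ← Real.exp_add]
  congr 1
  field_simp
  ring

theorem rpow_neg_half (x : ℝ) (hx : 0 ≤ x) : x ^ (-(1:ℝ) / 2) = (√x)⁻¹ := by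
  rw [neg_div, Real.rpow_neg hx, Real.sqrt_eq_rpow]

theorem gauss_conv (A B x : ℝ) (hA : 0 < A) (hB : 0 < B) :
    Integrable (fun y : ℝ => ((4 * Real.pi * A) ^ (-(1:ℝ) / 2) * Real.exp (-(x - y) ^ 2 / (4 * A))) *
      ((4 * Real.pi * B) ^ (-(1:ℝ) / 2) * Real.exp (-y ^ 2 / (4 * B)))) ∧
    ∫ y : ℝ, ((4 * Real.pi * A) ^ (-(1:ℝ) / 2) * Real.exp (-(x - y) ^ 2 / (4 * A))) *
      ((4 * Real.pi * B) ^ (-(1:ℝ) / 2) * Real.exp (-y ^ 2 / (4 * B))) =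
      (4 * Real.pi * (A + B)) ^ (-(1:ℝ) / 2) * Real.exp (-x ^ 2 / (4 * (A + B))) := by
  have hAB : 0 < A + B := by positivity
  have hpi := Real.pi_pos
  have hc : 0 < (A + B) / (4 * A * B) := by positivity
  set K : ℝ := (4 * Real.pi * A) ^ (-(1:ℝ) / 2) * (4 * Real.pi * B) ^ (-(1:ℝ) / 2) *
    Real.exp (-x ^ 2 / (4 * (A + B))) with hK
  have e : (fun y : ℝ => ((4 * Real.pi * A) ^ (-(1:ℝ) / 2) * Real.exp (-(x - y) ^ 2 / (4 * A))) *
      ((4 * Real.pi * B) ^ (-(1:ℝ) / 2) * Real.exp (-y ^ 2 / (4 * B)))) =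
      fun y => K * Real.exp (-((A + B) / (4 * A * B)) * (y - B * x / (A + B)) ^ 2) := by
    funext y
    have := gauss_sq A B x y hA hB
    rw [hK]
    linear_combination ((4 * Real.pi * A) ^ (-(1:ℝ) / 2) * (4 * Real.pi * B) ^ (-(1:ℝ) / 2)) * this
  rw [e]
  refine ⟨((integrable_exp_neg_mul_sq hc).comp_sub_right (B * x / (A + B))).const_mul K, ?_⟩
  rw [integral_const_mul, integral_sub_right_eq_self (fun y => Real.exp (-((A + B) / (4 * A * B)) * y ^ 2)),
    integral_gaussian, hK, rpow_neg_half _ (by positivity), rpow_neg_half _ (by positivity),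
    rpow_neg_half _ (by positivity)]
  have h1 : √(Real.pi / ((A + B) / (4 * A * B))) = √(4 * Real.pi * A) * √(4 * Real.pi * B) / √(4 * Real.pi * (A + B)) := by
    rw [← Real.sqrt_mul (by positivity), ← Real.sqrt_div (by positivity)]
    congr 1
    field_simp
  rw [h1]
  have : 0 < √(4 * Real.pi * A) := by positivity
  have : 0 < √(4 * Real.pi * B) := by positivity
  have : 0 < √(4 * Real.pi * (A + B)) := by positivity
  field_simp

theorem conv_ge_one (β t s x : ℝ) (hβ : 1 ≤ β) (hs : 0 < s) (hst : s < t) :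
    Integrable (fun y => refKernel β (t - s) (x - y) * refKernel β s y) ∧
    ∫ y, refKernel β (t - s) (x - y) * refKernel β s y ≤ (2:ℝ) ^ ((β - 1) / 2) * refKernel β t x := by
  have hn : ¬ β < 1 := not_lt.2 hβ
  simp only [refKernel, if_neg hn]
  have hts : 0 < t - s := by linarith
  have ht : 0 < t := by linarith
  have hA : 0 < (t - s) ^ β := by positivity
  have hB : 0 < s ^ β := by positivity
  have hT : 0 < t ^ β := by positivity
  have hpi := Real.pi_pos
  obtain ⟨h1, h2⟩ := gauss_conv ((t - s) ^ β) (s ^ β) x hA hB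
  refine ⟨h1, h2.le.trans ?_⟩
  have hle : (t - s) ^ β + s ^ β ≤ t ^ β := by
    have := Real.add_rpow_le_rpow_add hts.le hs.le hβ
    simpa using this
  have hge : (2:ℝ) ^ (1 - β) * t ^ β ≤ (t - s) ^ β + s ^ β := by
    have := real_pow_mean hts.le hs.le hβ
    rw [sub_add_cancel] at this
    have e : (2:ℝ) ^ (1 - β) * 2 ^ (β - 1) = 1 := by
      rw [← Real.rpow_add (by norm_num)]; norm_num
    calc (2:ℝ) ^ (1 - β) * t ^ β ≤ (2:ℝ) ^ (1 - β) * (2 ^ (β - 1) * ((t - s) ^ β + s ^ β)) := by gcongr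
      _ = ((2:ℝ) ^ (1 - β) * 2 ^ (β - 1)) * ((t - s) ^ β + s ^ β) := by ring
      _ = _ := by rw [e, one_mul]
  have hexp : Real.exp (-x ^ 2 / (4 * ((t - s) ^ β + s ^ β))) ≤ Real.exp (-x ^ 2 / (4 * t ^ β)) := by
    apply Real.exp_le_exp.2
    rw [neg_div, neg_div]
    apply neg_le_neg
    gcongr
  have hpw : (4 * Real.pi * ((t - s) ^ β + s ^ β)) ^ (-(1:ℝ) / 2) ≤
      (2:ℝ) ^ ((β - 1) / 2) * (4 * Real.pi * t ^ β) ^ (-(1:ℝ) / 2) := by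
    calc (4 * Real.pi * ((t - s) ^ β + s ^ β)) ^ (-(1:ℝ) / 2)
        ≤ ((2:ℝ) ^ (1 - β) * (4 * Real.pi * t ^ β)) ^ (-(1:ℝ) / 2) := by
          apply Real.rpow_le_rpow_of_nonpos (by positivity) _ (by norm_num)
          nlinarith
      _ = _ := by
          rw [Real.mul_rpow (by positivity) (by positivity), ← Real.rpow_mul (by norm_num)]
          congr 2; ring
  calc _ ≤ ((2:ℝ) ^ ((β - 1) / 2) * (4 * Real.pi * t ^ β) ^ (-(1:ℝ) / 2)) * Real.exp (-x ^ 2 / (4 * t ^ β)) :=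
        mul_le_mul hpw hexp (by positivity) (by positivity)
    _ = _ := by ring

theorem refKernel_pos (β t x : ℝ) (ht : 0 < t) : 0 < refKernel β t x := by
  have := Real.pi_pos
  unfold refKernel
  split_ifs <;> positivity

theorem refKernel_scale (β t x : ℝ) (ht : 0 < t) :
    refKernel β t x = t ^ (-(β / 2)) * refKernel β 1 (x / t ^ (β / 2)) := by
  have hpi := Real.pi_pos
  have hc : 0 < t ^ (β / 2) := by positivity
  unfold refKernel
  split_ifs
  · rw [abs_div, abs_of_pos hc, Real.one_rpow, Real.rpow_neg ht.le]
    rw [neg_div, div_one, mul_one]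
    field_simp
  · have e : t ^ β = (t ^ (β / 2)) ^ 2 := by
      rw [← Real.rpow_natCast, ← Real.rpow_mul ht.le]; congr 1; push_cast; ring
    rw [Real.one_rpow, mul_one, mul_one, Real.mul_rpow (by positivity) (by positivity),
      ← Real.rpow_mul ht.le]
    have e2 : β * (-1 / 2) = -(β / 2) := by ring
    rw [e2]
    have e3 : -(x / t ^ (β / 2)) ^ 2 / 4 = -x ^ 2 / (4 * t ^ β) := by
      rw [e]; field_simp
    rw [e3]
    ring

theorem greenG_scale (β t x : ℝ) (ht : 0 < t) :
    greenG β t x = t ^ ((⌈β⌉₊ : ℝ) - 1 - β / 2) * greenG β 1 (x / t ^ (β / 2)) := by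
  have hc : 0 < t ^ (β / 2) := by positivity
  unfold greenG
  rw [abs_div, abs_of_pos hc, Real.one_rpow, Real.one_rpow, div_one]
  ring

theorem L0_bound (β lam σ Ψ t x : ℝ) (hβ0 : 0 < β) (hβ2 : β < 2) (ht : 0 < t)
    (hσ : σ = β / 2 + 2 * (1 - (⌈β⌉₊ : ℝ)))
    (hΨ : Ψ = ⨆ x : ℝ, greenG β 1 x ^ 2 / refKernel β 1 x) :
    lam ^ 2 * greenG β t x ^ 2 ≤ lam ^ 2 * Ψ * t ^ ((1 - σ) - 1) * refKernel β t x := by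
  obtain ⟨z, hz⟩ : ∃ z, z = x / t ^ (β / 2) := ⟨_, rfl⟩
  have h1 : greenG β 1 z ^ 2 ≤ Ψ * refKernel β 1 z := by
    rw [← div_le_iff₀ (refKernel_pos β 1 z one_pos), hΨ]
    exact le_ciSup (ratio_bdd β hβ0 hβ2) z
  rw [greenG_scale β t x ht, refKernel_scale β t x ht, ← hz, mul_pow]
  have e : (t ^ ((⌈β⌉₊ : ℝ) - 1 - β / 2)) ^ 2 = t ^ ((1 - σ) - 1) * t ^ (-(β / 2)) := by
    rw [← Real.rpow_natCast, ← Real.rpow_mul ht.le, ← Real.rpow_add ht, hσ]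
    congr 1; push_cast; ring
  rw [e]
  calc lam ^ 2 * (t ^ ((1 - σ) - 1) * t ^ (-(β / 2)) * greenG β 1 z ^ 2)
      ≤ lam ^ 2 * (t ^ ((1 - σ) - 1) * t ^ (-(β / 2)) * (Ψ * refKernel β 1 z)) := by gcongr
    _ = _ := by ring


/-- upper bound on the kernel `𝒦(t,x;λ) = ∑_n ℒ_n(t,x)` built from
`ℒ_0 = λ² G_β²`: there is a finite constant `C` with
`𝒦(t,x;λ) ≤ (C/t^σ) 𝒢_β(t,x) (1 + t^σ e^{Υ t})`, where `σ = β/2 + 2(1−⌈β⌉)` and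
`Υ = (λ² Ψ_β C̃_β Γ(1−σ))^{1/(1−σ)}`. -/
theorem K_upper_bound_green (β lam : ℝ) (hβ0 : 0 < β) (hβ2 : β < 2) (hlam : 0 < lam)
    (σ Ψ Ct Υ : ℝ)
    (hσ : σ = β / 2 + 2 * (1 - (⌈β⌉₊ : ℝ)))
    (hΨ : Ψ = ⨆ x : ℝ, greenG β 1 x ^ 2 / refKernel β 1 x)
    (hCt : Ct = if β < 1
      then (2 : ℝ) ^ (β / 2) / ((2 : ℝ) ^ (β / 2) - 1) * Real.exp (-(2 : ℝ) ^ (-(β / 2)))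
      else (2 : ℝ) ^ ((β - 1) / 2))
    (hΥ : Υ = (lam ^ 2 * Ψ * Ct * Real.Gamma (1 - σ)) ^ (1 / (1 - σ))) :
    ∃ C : ℝ,
      ∀ t : ℝ, 0 < t → ∀ x : ℝ,
        Summable (fun n : ℕ => iterL (fun s y => lam ^ 2 * greenG β s y ^ 2) n t x) ∧
        (∑' n : ℕ, iterL (fun s y => lam ^ 2 * greenG β s y ^ 2) n t x)
          ≤ C / t ^ σ * refKernel β t x * (1 + t ^ σ * Real.exp (Υ * t)) := by
  have hα : 1 / 2 ≤ 1 - σ := by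
    rcases le_or_gt β 1 with h | h
    · rw [hσ, ceil_le_one hβ0 h]; push_cast; linarith
    · rw [hσ, ceil_gt_one h hβ2]; push_cast; linarith
  have hΨ0 : 0 ≤ Ψ := by
    rw [hΨ]
    exact Real.iSup_nonneg fun x => div_nonneg (sq_nonneg _) (refKernel_pos β 1 x one_pos).le
  have hCt0 : 0 < Ct := by
    rw [hCt]
    split_ifs with h
    · have hr : 1 < (2:ℝ) ^ (β / 2) := Real.one_lt_rpow (by norm_num) (by linarith)
      have : 0 < (2:ℝ) ^ (β / 2) - 1 := by linarith
      positivity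
    · positivity
  have hconv : ∀ t s x, 0 < s → s < t → s ≠ t / 2 →
      Integrable (fun y => refKernel β (t - s) (x - y) * refKernel β s y) ∧
      ∫ y, refKernel β (t - s) (x - y) * refKernel β s y ≤ Ct * refKernel β t x := by
    intro t s x hs hst hs2
    rw [hCt]
    split_ifs with h
    · exact conv_lt_one β t s x hβ0 h hs hst hs2
    · exact conv_ge_one β t s x (not_lt.1 h) hs hst
  have hk0 : 0 ≤ lam ^ 2 * Ψ := by positivity
  obtain ⟨C, hC⟩ := sum_bound (lam ^ 2 * Ψ) Ct (1 - σ) Υ hα hk0 hCt0 hΥ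
  have hit := iter_bound (refKernel β) (fun s y => lam ^ 2 * greenG β s y ^ 2) (lam ^ 2 * Ψ) Ct (1 - σ)
    (by linarith) hk0 hCt0.le (fun t x => by positivity)
    (fun t x ht => L0_bound β lam σ Ψ t x hβ0 hβ2 ht hσ hΨ)
    (fun t s x h1 h2 h3 => (hconv t s x h1 h2 h3).1)
    (fun t s x h1 h2 h3 => (hconv t s x h1 h2 h3).2)
  refine ⟨C, fun t ht x => ?_⟩
  obtain ⟨hs, hle⟩ := hC t ht
  have hs2 : Summable (fun n => Bn (lam ^ 2 * Ψ) Ct (1 - σ) n t * refKernel β t x) := hs.mul_right _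
  have hs1 : Summable (fun n : ℕ => iterL (fun s y => lam ^ 2 * greenG β s y ^ 2) n t x) :=
    Summable.of_nonneg_of_le (fun n => (hit n t x).1) (fun n => (hit n t x).2 ht) hs2
  refine ⟨hs1, ?_⟩
  have hr := refKernel_pos β t x ht
  calc (∑' n : ℕ, iterL (fun s y => lam ^ 2 * greenG β s y ^ 2) n t x)
      ≤ ∑' n, Bn (lam ^ 2 * Ψ) Ct (1 - σ) n t * refKernel β t x :=
        hs1.tsum_le_tsum (fun n => (hit n t x).2 ht) hs2
    _ = (∑' n, Bn (lam ^ 2 * Ψ) Ct (1 - σ) n t) * refKernel β t x := tsum_mul_right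
    _ ≤ (C * (t ^ ((1 - σ) - 1) + Real.exp (Υ * t))) * refKernel β t x := by gcongr
    _ = _ := by
      have e : t ^ ((1 - σ) - 1) = (t ^ σ)⁻¹ := by
        rw [← Real.rpow_neg ht.le]; congr 1; ring
      have hts : 0 < t ^ σ := by positivity
      rw [e]
      field_simp
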